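/- arXiv:1901.05934 — 3 statements merged into one kernel-verified Lean document; each statement's English description precedes it below -/
import Mathlib

section
/- Fix a smooth even function χ : ℝ → [0,1] with χ = 1 on [-1,1] and support in [-2,2]. There is a constant C > 0, depending only on χ, with the following property. Let t > 0, ε > 0, M ≥ 1 with M·ε·t^{1/3} ≤ 1, and let u : ℝ → ℝ be a Schwartz function satisfying the bootstrap bounds with constants M, ε at time t, as well as ‖u‖_{B^{-1/2,ε}_{2,∞}} ≤ ε and ‖L^{NL}u(t)‖_{Ḣ^{1/2}} ≤ M·ε. Let u^± := 𝓕^{-1}(1_{±ξ>0}(1-χ(t^{1/3}ξ))·𝓕u(ξ)), ∂ₓ^{-1}u^± := 𝓕^{-1}((iξ)^{-1}𝓕u^±), and |D|^{-3/2}u^± := 𝓕^{-1}(|ξ|^{-3/2}𝓕u^±). Then for all x ∈ ℝ and both choices of sign: |∂ₓ^{-1}u^±(x)| ≤ C·M·ε·t^{1/4}·⟨x⟩^{-3/4} and ||D|^{-3/2}u^±(x)| ≤ C·M·ε·t^{1/2}·⟨x⟩^{-1}. -/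
open MeasureTheory Real SchwartzMap Set
open scoped FourierTransform

noncomputable section

/-- Fourier transform of a real-valued function on `ℝ`. -/
def FT (u : ℝ → ℝ) : ℝ → ℂ := 𝓕 (fun x => (u x : ℂ))

/-- Homogeneous Sobolev norm `‖u‖_{Ḣˢ}`. -/
def HsNorm (s : ℝ) (u : ℝ → ℝ) : ℝ :=
  (∫ ξ : ℝ, |ξ| ^ (2 * s) * ‖FT u ξ‖ ^ 2) ^ (1/2 : ℝ)

/-- Homogeneous Besov norm `‖u‖_{Ḃ^{-1/2}_{2,∞}}`. -/
def BesovNorm (u : ℝ → ℝ) : ℝ :=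
  ⨆ j : ℤ, (2:ℝ) ^ (-(j:ℝ)/2) *
    (∫ ξ in {ξ : ℝ | (2:ℝ)^j ≤ |ξ| ∧ |ξ| < (2:ℝ)^(j+1)}, ‖FT u ξ‖^2) ^ (1/2:ℝ)

/-- `L²` norm. -/
def L2Norm (u : ℝ → ℝ) : ℝ := (∫ x : ℝ, u x ^ 2) ^ (1/2:ℝ)

/-- `L²` norm restricted to a set. -/
def L2NormOn (A : Set ℝ) (u : ℝ → ℝ) : ℝ := (∫ x in A, u x ^ 2) ^ (1/2:ℝ)

/-- The time-dependent japanese bracket `⟨x⟩ = (x² + t^{2/3})^{1/2}`. -/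
def jb (t x : ℝ) : ℝ := (x^2 + t ^ ((2:ℝ)/3)) ^ (1/2:ℝ)

/-- The flattened Besov norm `‖u‖_{B^{-1/2,ε}_{2,∞}}`. -/
def BesovEpsNorm (ε : ℝ) (u : ℝ → ℝ) : ℝ :=
  sInf {c : ℝ | ∃ g h : ℝ → ℝ, u = g + h ∧ c = BesovNorm g + ε ^ (-(1:ℝ)/2) * L2Norm h}

/-- The bootstrap bounds with constants `M`, `ε` at time `t`. -/
def Bootstrap (M ε t : ℝ) (u : ℝ → ℝ) : Prop :=
  ∀ x : ℝ, |u x| ≤ M * ε * t ^ (-(1:ℝ)/4) * jb t x ^ (-(1:ℝ)/4) ∧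
    |deriv u x| ≤ M * ε * t ^ (-(3:ℝ)/4) * jb t x ^ ((1:ℝ)/4)

/-- The nonlinear operator `L^{NL}u(t)(x) = x·u(x) - 3t·u''(x) + 9t·u(x)²`. -/
def LNL (t : ℝ) (u : ℝ → ℝ) : ℝ → ℝ :=
  fun x => x * u x - 3 * t * iteratedDeriv 2 u x + 9 * t * u x ^ 2

/-- `χ` is a smooth even cutoff, valued in `[0,1]`, equal to `1` on `[-1,1]`,
supported in `[-2,2]`. -/
def IsCutoff (χ : ℝ → ℝ) : Prop :=
  ContDiff ℝ (⊤ : ℕ∞) χ ∧ (∀ x, χ (-x) = χ x) ∧ (∀ x, 0 ≤ χ x ∧ χ x ≤ 1) ∧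
    (∀ x ∈ Set.Icc (-1:ℝ) 1, χ x = 1) ∧ Function.support χ ⊆ Set.Icc (-2:ℝ) 2

/-- The positive/negative high frequency parts
`u^± = 𝓕⁻¹(1_{±ξ>0}(1-χ(t^{1/3}ξ))𝓕u)`, with `s = ±1`. -/
def uPM (χ : ℝ → ℝ) (t : ℝ) (u : ℝ → ℝ) (s : ℝ) : ℝ → ℂ :=
  𝓕⁻ (fun ξ : ℝ => (if 0 < s * ξ then (1:ℂ) else 0) *
    (1 - ((χ (t ^ ((1:ℝ)/3) * ξ) : ℝ) : ℂ)) * FT u ξ)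

/-- The antiderivative `∂ₓ^{-1}v = 𝓕⁻¹((iξ)^{-1}𝓕v)`. -/
def invDerivOf (v : ℝ → ℂ) : ℝ → ℂ :=
  𝓕⁻ (fun ξ : ℝ => (Complex.I * (ξ:ℂ))⁻¹ * 𝓕 v ξ)

/-- The operator `|D|^{-3/2}v = 𝓕⁻¹(|ξ|^{-3/2}𝓕v)`. -/
def absDinv32 (v : ℝ → ℂ) : ℝ → ℂ :=
  𝓕⁻ (fun ξ : ℝ => ((|ξ| ^ (-(3:ℝ)/2) : ℝ) : ℂ) * 𝓕 v ξ)

/-- `f` and its first `n` derivatives are bounded by `C * w`, the last one being continuous. -/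
def DerivBound : ℕ → ℝ → (ℝ → ℝ) → (ℝ → ℝ) → Prop
  | 0, C, w, f => Continuous f ∧ ∀ x, |f x| ≤ C * w x
  | n + 1, C, w, f => (∀ x, |f x| ≤ C * w x) ∧
      ∃ f' : ℝ → ℝ, (∀ x, HasDerivAt f (f' x) x) ∧ DerivBound n C w f'

namespace DerivBound

lemma bound {n : ℕ} {C : ℝ} {w f : ℝ → ℝ} (h : DerivBound n C w f) (x : ℝ) :
    |f x| ≤ C * w x := by
  cases n with
  | zero => exact h.2 x
  | succ n => exact h.1 x

lemma continuous {n : ℕ} {C : ℝ} {w f : ℝ → ℝ} (h : DerivBound n C w f) : Continuous f := by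
  cases n with
  | zero => exact h.1
  | succ n =>
    obtain ⟨_, f', hf, _⟩ := h
    exact continuous_iff_continuousAt.2 fun x => (hf x).continuousAt

lemma of_succ {n : ℕ} {C : ℝ} {w f : ℝ → ℝ} (h : DerivBound (n + 1) C w f) :
    DerivBound n C w f := by
  induction n generalizing f with
  | zero => exact ⟨h.continuous, h.bound⟩
  | succ n ih =>
    obtain ⟨h0, f', hf, h'⟩ := h
    exact ⟨h0, f', hf, ih h'⟩

lemma mono {n : ℕ} {C D : ℝ} {w v f : ℝ → ℝ} (h : DerivBound n C w f)
    (hw : ∀ x, C * w x ≤ D * v x) : DerivBound n D v f := by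
  induction n generalizing f with
  | zero => exact ⟨h.1, fun x => (h.2 x).trans (hw x)⟩
  | succ n ih =>
    obtain ⟨h0, f', hf, h'⟩ := h
    exact ⟨fun x => (h0 x).trans (hw x), f', hf, ih h'⟩

lemma add {n : ℕ} {C D : ℝ} {w f g : ℝ → ℝ} (hf : DerivBound n C w f)
    (hg : DerivBound n D w g) : DerivBound n (C + D) w (fun x => f x + g x) := by
  have key : ∀ {f g : ℝ → ℝ}, (∀ x, |f x| ≤ C * w x) → (∀ x, |g x| ≤ D * w x) →
      ∀ x, |f x + g x| ≤ (C + D) * w x := fun h1 h2 x => by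
    rw [add_mul]
    exact (abs_add_le _ _).trans (add_le_add (h1 x) (h2 x))
  induction n generalizing f g with
  | zero => exact ⟨hf.1.add hg.1, key hf.2 hg.2⟩
  | succ n ih =>
    obtain ⟨hf0, f', hf1, hf2⟩ := hf
    obtain ⟨hg0, g', hg1, hg2⟩ := hg
    exact ⟨key hf0 hg0, _, fun x => (hf1 x).add (hg1 x), ih hf2 hg2⟩

lemma const_mul {n : ℕ} {C : ℝ} {w f : ℝ → ℝ} (c : ℝ) (hf : DerivBound n C w f) :
    DerivBound n (|c| * C) w (fun x => c * f x) := by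
  have key : ∀ {f : ℝ → ℝ}, (∀ x, |f x| ≤ C * w x) →
      ∀ x, |c * f x| ≤ |c| * C * w x := fun h1 x => by
    rw [abs_mul, mul_assoc]
    exact mul_le_mul_of_nonneg_left (h1 x) (abs_nonneg c)
  induction n generalizing f with
  | zero => exact ⟨hf.1.const_mul c, key hf.2⟩
  | succ n ih =>
    obtain ⟨hf0, f', hf1, hf2⟩ := hf
    exact ⟨key hf0, _, fun x => (hf1 x).const_mul c, ih hf2⟩

lemma mul {n : ℕ} {C D : ℝ} {w v f g : ℝ → ℝ} (hf : DerivBound n C w f)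
    (hg : DerivBound n D v g) :
    DerivBound n (2 ^ n * (C * D)) (fun x => w x * v x) (fun x => f x * g x) := by
  have key : ∀ {f g : ℝ → ℝ}, (∀ x, |f x| ≤ C * w x) → (∀ x, |g x| ≤ D * v x) →
      ∀ x, |f x * g x| ≤ (C * D) * (w x * v x) := fun h1 h2 x => by
    rw [abs_mul]
    calc _ ≤ (C * w x) * (D * v x) :=
          mul_le_mul (h1 x) (h2 x) (abs_nonneg _) ((abs_nonneg _).trans (h1 x))
      _ = _ := by ring
  induction n generalizing f g with
  | zero => exact ⟨hf.1.mul hg.1, by simpa using key hf.2 hg.2⟩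
  | succ n ih =>
    have h1 := hf.of_succ
    have h2 := hg.of_succ
    obtain ⟨hf0, f', hf1, hf2⟩ := hf
    obtain ⟨hg0, g', hg1, hg2⟩ := hg
    refine ⟨fun x => (key hf0 hg0 x).trans ?_, _, fun x => (hf1 x).mul (hg1 x), ?_⟩
    · have h0 := (abs_nonneg _).trans (key hf0 hg0 x)
      have : (1 : ℝ) ≤ 2 ^ (n + 1) := one_le_pow₀ (by norm_num)
      nlinarith
    · convert (ih hf2 h2).add (ih h1 hg2) using 1
      ring

lemma comp_mul {n : ℕ} {C : ℝ} {w f : ℝ → ℝ} (hf : DerivBound n C w f) {s : ℝ}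
    (hs : |s| ≤ 1) : DerivBound n C (fun x => w (s * x)) (fun x => f (s * x)) := by
  induction n generalizing f with
  | zero => exact ⟨hf.1.comp (continuous_const.mul continuous_id), fun x => hf.2 _⟩
  | succ n ih =>
    obtain ⟨hf0, f', hf1, hf2⟩ := hf
    refine ⟨fun x => hf0 _, fun x => s * f' (s * x), fun x => ?_, ?_⟩
    · have := (hf1 (s * x)).comp x ((hasDerivAt_id x).const_mul s)
      simpa [mul_comm, Function.comp_def] using this
    · refine (const_mul s (ih hf2)).mono fun x => ?_
      have h0 := (abs_nonneg _).trans (hf2.bound (s * x))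
      rw [mul_assoc]
      exact mul_le_of_le_one_left h0 hs

lemma of_hasCompactSupport {f w : ℝ → ℝ} (hf : ContDiff ℝ (⊤ : ℕ∞) f)
    (hc : HasCompactSupport f) (hw : Continuous w) (hpos : ∀ x, 0 < w x) (n : ℕ) :
    ∃ C, 0 ≤ C ∧ DerivBound n C w f := by
  have key : ∀ {f : ℝ → ℝ}, Continuous f → HasCompactSupport f →
      ∃ C, 0 ≤ C ∧ ∀ x, |f x| ≤ C * w x := by
    intro f hf hc
    have h1 : Continuous fun x => f x * (w x)⁻¹ := hf.mul (hw.inv₀ fun x => (hpos x).ne')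
    obtain ⟨C, hC⟩ := h1.bounded_above_of_compact_support (hc.mul_right)
    refine ⟨C, (norm_nonneg _).trans (hC 0), fun x => ?_⟩
    have := hC x
    rw [norm_mul, norm_inv, Real.norm_eq_abs, Real.norm_eq_abs, abs_of_pos (hpos x),
      ← div_eq_mul_inv, div_le_iff₀ (hpos x)] at this
    exact this
  obtain ⟨C, hC0, hC⟩ := key hf.continuous hc
  induction n generalizing f C with
  | zero => exact ⟨C, hC0, hf.continuous, hC⟩
  | succ n ih =>
    have hf' : ContDiff ℝ (⊤ : ℕ∞) (deriv f) := hf.deriv' 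
    obtain ⟨D, hD0, hD⟩ := key hf'.continuous hc.deriv
    obtain ⟨E, hE0, hE⟩ := ih hf' hc.deriv D hD0 hD
    refine ⟨C + E, by positivity, fun x => (hC x).trans ?_, deriv f, fun x => ?_,
      hE.mono fun x => ?_⟩
    · have := (hpos x).le; gcongr; linarith
    · exact (hf.differentiable (by simp) x).hasDerivAt
    · have := (hpos x).le; gcongr; linarith

end DerivBound

/-- Smooth functions all of whose derivatives are bounded. -/
def SmoothBdd (f : ℝ → ℝ) : Prop :=
  ContDiff ℝ (⊤ : ℕ∞) f ∧ ∀ k : ℕ, ∃ C, ∀ x, |iteratedDeriv k f x| ≤ C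

namespace SmoothBdd

lemma bound {f : ℝ → ℝ} (h : SmoothBdd f) : ∃ C, 0 ≤ C ∧ ∀ x, |f x| ≤ C := by
  obtain ⟨C, hC⟩ := h.2 0
  simp only [iteratedDeriv_zero] at hC
  exact ⟨C, (abs_nonneg _).trans (hC 0), hC⟩

lemma hasDerivAt {f : ℝ → ℝ} (h : SmoothBdd f) (x : ℝ) : HasDerivAt f (deriv f x) x :=
  (h.1.differentiable (by simp) x).hasDerivAt

lemma deriv {f : ℝ → ℝ} (h : SmoothBdd f) : SmoothBdd (deriv f) := by
  refine ⟨h.1.deriv', fun k => ?_⟩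
  obtain ⟨C, hC⟩ := h.2 (k + 1)
  exact ⟨C, by simpa [iteratedDeriv_succ'] using hC⟩

lemma of_deriv_hasCompactSupport {f : ℝ → ℝ} (hf : ContDiff ℝ (⊤ : ℕ∞) f) {C : ℝ}
    (hC : ∀ x, |f x| ≤ C) (hc : HasCompactSupport (_root_.deriv f)) : SmoothBdd f := by
  refine ⟨hf, fun k => ?_⟩
  cases k with
  | zero => exact ⟨C, by simpa using hC⟩
  | succ k =>
    have hc' : HasCompactSupport (iteratedDeriv (k + 1) f) := by
      rw [iteratedDeriv_succ']
      clear hC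
      generalize _root_.deriv f = g at hc
      induction k generalizing g with
      | zero => simpa using hc
      | succ k ih => rw [iteratedDeriv_succ']; exact ih _ hc.deriv
    obtain ⟨D, hD⟩ := (hf.continuous_iteratedDeriv (k + 1)
      (by exact_mod_cast le_top)).bounded_above_of_compact_support hc'
    exact ⟨D, hD⟩

end SmoothBdd

lemma DerivBound.smoothBdd_mul_rpow {a : ℝ} (ha : 0 ≤ a) (n : ℕ) {ψ : ℝ → ℝ}
    (hψ : SmoothBdd ψ) (h0 : ∀ x < 1, ψ x = 0) {b : ℝ} (hab : a ≤ b) :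
    ∃ C, 0 ≤ C ∧ DerivBound n C (fun x => (1 + |x|) ^ (-a)) (fun x => ψ x * x ^ (-b)) := by
  have key : ∀ (ψ : ℝ → ℝ) (b : ℝ), SmoothBdd ψ → (∀ x < 1, ψ x = 0) → a ≤ b →
      ∃ C, 0 ≤ C ∧ ∀ x, |ψ x * x ^ (-b)| ≤ C * (1 + |x|) ^ (-a) := by
    intro ψ b hψ h0 hab
    obtain ⟨C, hC0, hC⟩ := hψ.bound
    refine ⟨C * 2 ^ a, by positivity, fun x => ?_⟩
    rcases lt_or_ge x 1 with hx | hx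
    · rw [h0 x hx]; simp; positivity
    · have hx0 : 0 < x := by linarith
      rw [abs_mul, abs_of_pos (Real.rpow_pos_of_pos hx0 _), abs_of_pos hx0, mul_assoc]
      refine mul_le_mul (hC x) ?_ (by positivity) hC0
      calc x ^ (-b) ≤ x ^ (-a) := Real.rpow_le_rpow_of_exponent_le hx (by linarith)
        _ ≤ ((1 + x) / 2) ^ (-a) :=
          Real.rpow_le_rpow_of_nonpos (by linarith) (by linarith) (by linarith)
        _ = 2 ^ a * (1 + x) ^ (-a) := by
          rw [Real.div_rpow (by linarith) (by norm_num), Real.rpow_neg (x := 2) (by norm_num)]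
          field_simp
  have hd0 : ∀ ψ : ℝ → ℝ, (∀ x < 1, ψ x = 0) → ∀ x < 1, ψ =ᶠ[nhds x] fun _ => 0 :=
    fun ψ h0 x hx => by
      filter_upwards [Iio_mem_nhds hx] with y hy using h0 y hy
  induction n generalizing ψ b with
  | zero =>
    obtain ⟨C, hC0, hC⟩ := key ψ b hψ h0 hab
    refine ⟨C, hC0, continuous_iff_continuousAt.2 fun x => ?_, hC⟩
    rcases lt_or_ge x 1 with hx | hx
    · refine (continuousAt_const (y := (0 : ℝ))).congr ?_
      filter_upwards [hd0 ψ h0 x hx] with y hy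
      simp [hy]
    · exact hψ.1.continuous.continuousAt.mul
        (Real.continuousAt_rpow_const _ _ (Or.inl (by linarith)))
  | succ n ih =>
    have h0' : ∀ x < 1, deriv ψ x = 0 := fun x hx => by
      rw [(hd0 ψ h0 x hx).deriv_eq]; simp
    obtain ⟨C, hC0, hC⟩ := key ψ b hψ h0 hab
    obtain ⟨D, hD0, hD⟩ := ih hψ.deriv h0' hab
    obtain ⟨E, hE0, hE⟩ := ih hψ h0 (b := b + 1) (by linarith)
    refine ⟨C + (D + |-b| * E), by positivity, fun x => (hC x).trans ?_, _, fun x => ?_,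
      (hD.add (hE.const_mul (-b))).mono fun x => ?_⟩
    · gcongr; linarith [mul_nonneg (abs_nonneg (-b)) hE0]
    · rcases lt_or_ge x 1 with hx | hx
      · simp only [h0' x hx, h0 x hx, zero_mul, mul_zero, add_zero]
        refine (hasDerivAt_const x (0 : ℝ)).congr_of_eventuallyEq ?_
        filter_upwards [hd0 ψ h0 x hx] with y hy
        simp [hy]
      · have := (hψ.hasDerivAt x).mul
          (Real.hasDerivAt_rpow_const (x := x) (p := -b) (Or.inl (by linarith)))
        refine this.congr_deriv ?_
        rw [neg_add']
        ring
    · exact mul_le_mul_of_nonneg_right (by linarith) (by positivity)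

lemma DerivBound.smoothBdd_mul_pow_mul_inv {σ : ℝ} (hσ : |σ| ≤ 1) (n : ℕ) {ψ : ℝ → ℝ}
    (hψ : SmoothBdd ψ) (h0 : ∀ x, |x ^ 2 + σ| < 1 / 4 → ψ x = 0) {i j : ℕ}
    (hij : j + 1 ≤ 2 * i) :
    ∃ C, 0 ≤ C ∧ DerivBound n C (fun x => (1 + |x|)⁻¹)
      (fun x => ψ x * (x ^ j * ((x ^ 2 + σ)⁻¹) ^ i)) := by
  have key : ∀ (ψ : ℝ → ℝ) (i j : ℕ), SmoothBdd ψ → (∀ x, |x ^ 2 + σ| < 1 / 4 → ψ x = 0) →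
      j + 1 ≤ 2 * i →
      ∃ C, 0 ≤ C ∧ ∀ x, |ψ x * (x ^ j * ((x ^ 2 + σ)⁻¹) ^ i)| ≤ C * (1 + |x|)⁻¹ := by
    intro ψ i j hψ h0 hij
    obtain ⟨C, hC0, hC⟩ := hψ.bound
    refine ⟨C * 18 ^ i, by positivity, fun x => ?_⟩
    rcases lt_or_ge |x ^ 2 + σ| (1 / 4) with hx | hx
    · rw [h0 x hx]; simp; positivity
    · rw [abs_mul, mul_assoc]
      refine mul_le_mul (hC x) ?_ (by positivity) hC0
      rw [← div_eq_mul_inv, le_div_iff₀ (by positivity), abs_mul, abs_pow, abs_pow, abs_inv]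
      have hA : (1 + |x|) ^ 2 * |x ^ 2 + σ|⁻¹ ≤ 18 := by
        rw [← div_eq_mul_inv, div_le_iff₀ (by linarith)]
        have h1 : x ^ 2 ≤ |x ^ 2 + σ| + 1 := by
          have := le_abs_self (x ^ 2 + σ)
          have := neg_abs_le σ
          linarith
        have h2 : |x| ^ 2 = x ^ 2 := sq_abs x
        nlinarith [sq_nonneg (|x| - 1)]
      calc |x| ^ j * |x ^ 2 + σ|⁻¹ ^ i * (1 + |x|)
          ≤ (1 + |x|) ^ j * |x ^ 2 + σ|⁻¹ ^ i * (1 + |x|) := by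
            gcongr; linarith
        _ = (1 + |x|) ^ (j + 1) * |x ^ 2 + σ|⁻¹ ^ i := by ring
        _ ≤ (1 + |x|) ^ (2 * i) * |x ^ 2 + σ|⁻¹ ^ i := by
            gcongr
            linarith [abs_nonneg x]
        _ = ((1 + |x|) ^ 2 * |x ^ 2 + σ|⁻¹) ^ i := by rw [mul_pow, pow_mul]
        _ ≤ 18 ^ i := by gcongr
  have hd0 : ∀ ψ : ℝ → ℝ, (∀ x, |x ^ 2 + σ| < 1 / 4 → ψ x = 0) →
      ∀ x, |x ^ 2 + σ| < 1 / 4 → ψ =ᶠ[nhds x] fun _ => 0 := fun ψ h0 x hx => by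
    have : IsOpen {y : ℝ | |y ^ 2 + σ| < 1 / 4} :=
      isOpen_lt (by fun_prop) continuous_const
    filter_upwards [this.mem_nhds hx] with y hy using h0 y hy
  induction n generalizing ψ i j with
  | zero =>
    obtain ⟨C, hC0, hC⟩ := key ψ i j hψ h0 hij
    refine ⟨C, hC0, continuous_iff_continuousAt.2 fun x => ?_, hC⟩
    rcases lt_or_ge |x ^ 2 + σ| (1 / 4) with hx | hx
    · refine (continuousAt_const (y := (0 : ℝ))).congr ?_
      filter_upwards [hd0 ψ h0 x hx] with y hy
      simp [hy]
    · have hne : x ^ 2 + σ ≠ 0 := fun h => by rw [h] at hx; norm_num at hx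
      exact hψ.1.continuous.continuousAt.mul ((by fun_prop : ContinuousAt _ x).mul
        (((by fun_prop : ContinuousAt (fun x : ℝ => x ^ 2 + σ) x).inv₀ hne).pow i))
  | succ n ih =>
    have h0' : ∀ x, |x ^ 2 + σ| < 1 / 4 → deriv ψ x = 0 := fun x hx => by
      rw [(hd0 ψ h0 x hx).deriv_eq]; simp
    obtain ⟨C, hC0, hC⟩ := key ψ i j hψ h0 hij
    obtain ⟨D, hD0, hD⟩ := ih hψ.deriv h0' hij
    obtain ⟨E, hE0, hE⟩ := ih hψ h0 (i := i) (j := j - 1) (by omega)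
    obtain ⟨F, hF0, hF⟩ := ih hψ h0 (i := i + 1) (j := j + 1) (by omega)
    refine ⟨C + (D + (|(j : ℝ)| * E + |(-(2 * i) : ℝ)| * F)), by positivity,
      fun x => (hC x).trans ?_, _, fun x => ?_,
      (hD.add ((hE.const_mul (j : ℝ)).add (hF.const_mul (-(2 * i) : ℝ)))).mono fun x => ?_⟩
    · gcongr
      have : 0 ≤ D + (|(j : ℝ)| * E + |(-(2 * i) : ℝ)| * F) := by positivity
      linarith
    · rcases lt_or_ge |x ^ 2 + σ| (1 / 4) with hx | hx
      · simp only [h0' x hx, h0 x hx, zero_mul, mul_zero, add_zero]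
        refine (hasDerivAt_const x (0 : ℝ)).congr_of_eventuallyEq ?_
        filter_upwards [hd0 ψ h0 x hx] with y hy
        simp [hy]
      · have hne : x ^ 2 + σ ≠ 0 := fun h => by rw [h] at hx; norm_num at hx
        have h1 : HasDerivAt (fun x : ℝ => x ^ 2 + σ) (2 * x) x := by
          simpa using (hasDerivAt_pow 2 x).add_const σ
        have := (hψ.hasDerivAt x).mul ((hasDerivAt_pow j x).mul ((h1.inv hne).pow i))
        refine this.congr_deriv ?_
        have hi : i = (i - 1) + 1 := by omega
        simp only [Pi.mul_apply, Pi.pow_apply, Pi.inv_apply]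
        generalize hk : i - 1 = k at hi
        subst hi
        push_cast
        rw [neg_div, div_eq_mul_inv (2 * x), ← inv_pow]
        ring
    · exact mul_le_mul_of_nonneg_right (by linarith) (by positivity)
lemma norm_fourierChar (x : ℝ) : ‖((𝐞 x : Circle) : ℂ)‖ = 1 := Circle.norm_coe _

lemma integrable_one_add_abs_rpow {r : ℝ} (hr : 1 < r) :
    Integrable (fun x : ℝ => (1 + |x|) ^ (-r)) := by
  have := integrable_one_add_norm (E := ℝ) (μ := volume) (r := r) (by simpa using hr)
  simpa using this

lemma fourierInv_eq_integral (f : ℝ → ℂ) (y : ℝ) :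
    𝓕⁻ f y = ∫ x : ℝ, ((𝐞 (x * y) : Circle) : ℂ) * f x := by
  rw [Real.fourierInv_eq]
  simp [Circle.smul_def, mul_comm]

lemma fourier_eq_integral (f : ℝ → ℂ) (y : ℝ) :
    𝓕 f y = ∫ x : ℝ, ((𝐞 (-(x * y)) : Circle) : ℂ) * f x := by
  rw [Real.fourier_real_eq]
  simp [Circle.smul_def]

lemma norm_fourier_le_integral {f : ℝ → ℂ} {w : ℝ → ℝ} (hw : Integrable w)
    (h : ∀ x, ‖f x‖ ≤ w x) (y : ℝ) : ‖𝓕 f y‖ ≤ ∫ x, w x := by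
  rw [fourier_eq_integral]
  exact norm_integral_le_of_norm_le hw (Filter.Eventually.of_forall fun x => by
    rw [norm_mul, norm_fourierChar, one_mul]; exact h x)

lemma norm_fourierInv_le_integral {f : ℝ → ℂ} {w : ℝ → ℝ} (hw : Integrable w)
    (h : ∀ x, ‖f x‖ ≤ w x) (y : ℝ) : ‖𝓕⁻ f y‖ ≤ ∫ x, w x := by
  rw [fourierInv_eq_integral]
  exact norm_integral_le_of_norm_le hw (Filter.Eventually.of_forall fun x => by
    rw [norm_mul, norm_fourierChar, one_mul]; exact h x)

lemma fourier_comp_mul_left (f : ℝ → ℂ) {a : ℝ} (ha : 0 < a) (ξ : ℝ) :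
    𝓕 (fun x => f (a * x)) ξ = (a : ℂ)⁻¹ * 𝓕 f (ξ / a) := by
  rw [fourier_eq_integral, fourier_eq_integral]
  have := Measure.integral_comp_mul_left (fun x : ℝ => ((𝐞 (-(x * (ξ / a))) : Circle) : ℂ) * f x) a
  rw [abs_of_pos (inv_pos.2 ha)] at this
  convert this using 1
  · congr 1; ext x; congr 3; field_simp
  · simp

lemma fourierInv_comp_mul_left (f : ℝ → ℂ) {a : ℝ} (ha : 0 < a) (y : ℝ) :
    𝓕⁻ (fun x => f (a * x)) y = (a : ℂ)⁻¹ * 𝓕⁻ f (y / a) := by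
  rw [fourierInv_eq_integral, fourierInv_eq_integral]
  have := Measure.integral_comp_mul_left (fun x : ℝ => ((𝐞 (x * (y / a)) : Circle) : ℂ) * f x) a
  rw [abs_of_pos (inv_pos.2 ha)] at this
  convert this using 1
  · congr 1; ext x; congr 3; field_simp
  · simp

lemma fourierInv_sub_apply {f g : ℝ → ℂ} (hf : Integrable f) (hg : Integrable g) (y : ℝ) :
    𝓕⁻ (fun ξ => f ξ - g ξ) y = 𝓕⁻ f y - 𝓕⁻ g y := by
  simp only [fourierInv_eq_integral, mul_sub]
  have hc : Continuous fun x : ℝ => ((𝐞 (x * y) : Circle) : ℂ) := by fun_prop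
  exact integral_sub (hf.bdd_mul (c := 1) hc.aestronglyMeasurable
      (Filter.Eventually.of_forall fun x => (norm_fourierChar _).le))
    (hg.bdd_mul (c := 1) hc.aestronglyMeasurable
      (Filter.Eventually.of_forall fun x => (norm_fourierChar _).le))

lemma fourierInv_const_mul (c : ℂ) (f : ℝ → ℂ) (y : ℝ) :
    𝓕⁻ (fun ξ => c * f ξ) y = c * 𝓕⁻ f y := by
  simp only [fourierInv_eq_integral, mul_left_comm _ c, integral_const_mul]

lemma DerivBound.integrable_ofReal {n : ℕ} {C : ℝ} {w f : ℝ → ℝ} (h : DerivBound n C w f)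
    (hw : Integrable w) : Integrable (fun x => (f x : ℂ)) :=
  (hw.const_mul C).mono' (Complex.continuous_ofReal.comp h.continuous).aestronglyMeasurable
    (Filter.Eventually.of_forall fun x => by simpa using h.bound x)

lemma DerivBound.norm_fourier_le {n : ℕ} {C : ℝ} {w f : ℝ → ℝ} (h : DerivBound n C w f)
    (hw : Integrable w) (z : ℝ) :
    (2 * π * |z|) ^ n * ‖𝓕 (fun x => (f x : ℂ)) z‖ ≤ C * ∫ x, w x := by
  have key : ∀ {m : ℕ} {f : ℝ → ℝ}, DerivBound m C w f →
      ‖𝓕 (fun x => (f x : ℂ)) z‖ ≤ C * ∫ x, w x := fun h => by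
    rw [← integral_const_mul]
    exact norm_fourier_le_integral (hw.const_mul C) (fun x => by simpa using h.bound x) z
  induction n generalizing f with
  | zero => simpa using key h
  | succ n ih =>
    have hi := h.integrable_ofReal hw
    obtain ⟨h0, f', hf, h'⟩ := h
    have hd : ∀ x, HasDerivAt (fun x => (f x : ℂ)) (f' x : ℂ) x :=
      fun x => (hf x).ofReal_comp
    have hde : deriv (fun x => (f x : ℂ)) = fun x => (f' x : ℂ) := funext fun x => (hd x).deriv
    have := Real.fourier_deriv hi (fun x => (hd x).differentiableAt)
      (by rw [hde]; exact h'.integrable_ofReal hw)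
    rw [hde] at this
    have h2 := ih h'
    rw [this, norm_smul] at h2
    calc _ = (2 * π * |z|) ^ n * (‖(2 * π * Complex.I * z : ℂ)‖ *
          ‖𝓕 (fun x => (f x : ℂ)) z‖) := by
          simp [abs_of_pos Real.pi_pos]; ring
      _ ≤ _ := h2

lemma DerivBound.norm_fourier_le_rpow {C : ℝ} {w f : ℝ → ℝ} (h : DerivBound 3 C w f)
    (hw : Integrable w) (z : ℝ) :
    ‖𝓕 (fun x => (f x : ℂ)) z‖ * (1 + |z|) ≤ 8 * (C * ∫ x, w x) * (1 + |z|) ^ (-2 : ℝ) := by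
  have h3 := h.norm_fourier_le hw z
  have h0 := (h.of_succ.of_succ.of_succ).norm_fourier_le hw z
  rw [pow_zero, one_mul] at h0
  set B := C * ∫ x, w x
  set A := ‖𝓕 (fun x => (f x : ℂ)) z‖
  have hA : 0 ≤ A := norm_nonneg _
  have hz : 0 ≤ |z| := abs_nonneg z
  have h4 : (1 + |z|) ^ 3 * A ≤ 8 * B := by
    have h5 : |z| ^ 3 * A ≤ (2 * π * |z|) ^ 3 * A := by
      gcongr
      nlinarith [Real.pi_gt_three]
    have h6 : (1 + |z|) ^ 3 ≤ 4 * (1 + |z| ^ 3) := by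
      nlinarith [mul_nonneg (add_nonneg zero_le_one hz) (sq_nonneg (|z| - 1))]
    nlinarith [mul_le_mul_of_nonneg_right h6 hA]
  rw [Real.rpow_neg (by positivity), Real.rpow_two, ← div_eq_mul_inv, le_div_iff₀ (by positivity)]
  calc _ = (1 + |z|) ^ 3 * A := by ring
    _ ≤ _ := h4

lemma DerivBound.norm_fourierInv_mul_fourier_le {C K y : ℝ} {w q : ℝ → ℝ}
    (hq : DerivBound 3 C w q) (hw : Integrable w) {g : ℝ → ℂ} (hg : Integrable g)
    (hK : ∀ z, ‖g z‖ ≤ K * (1 + |z - y|)) :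
    ‖𝓕⁻ (fun ξ => (q ξ : ℂ) * 𝓕 g ξ) y‖ ≤
      8 * (C * ∫ x, w x) * K * ∫ z : ℝ, (1 + |z|) ^ (-2 : ℝ) := by
  have hqi := hq.integrable_ofReal hw
  have hc : Continuous fun x : ℝ => ((𝐞 (x * y) : Circle) : ℂ) := by fun_prop
  have hi : Integrable fun ξ : ℝ => ((𝐞 (ξ * y) : Circle) : ℂ) * q ξ :=
    hqi.bdd_mul (c := 1) hc.aestronglyMeasurable
      (Filter.Eventually.of_forall fun x => (norm_fourierChar _).le)
  have h1 : 𝓕⁻ (fun ξ => (q ξ : ℂ) * 𝓕 g ξ) y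
      = ∫ z, 𝓕 (fun ξ : ℝ => ((𝐞 (ξ * y) : Circle) : ℂ) * q ξ) z * g z := by
    rw [fourierInv_eq_integral]
    have := VectorFourier.integral_fourierIntegral_smul_eq_flip (L := innerₗ ℝ) (μ := volume)
      (ν := volume) continuous_fourierChar continuous_inner hi hg
    rw [flip_innerₗ] at this
    simp only [smul_eq_mul] at this
    refine Eq.trans ?_ this.symm
    congr 1
    ext ξ
    rw [mul_assoc]
    rfl
  have h2 : ∀ z, 𝓕 (fun ξ : ℝ => ((𝐞 (ξ * y) : Circle) : ℂ) * q ξ) z = 𝓕 (fun ξ => (q ξ : ℂ)) (z - y) := by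
    intro z
    rw [fourier_eq_integral, fourier_eq_integral]
    congr 1
    ext ξ
    rw [← mul_assoc, ← Circle.coe_mul, ← AddChar.map_add_eq_mul]
    congr 3
    ring
  have hInt : Integrable fun z : ℝ => (1 + |z - y|) ^ (-2 : ℝ) :=
    (integrable_one_add_abs_rpow (r := 2) (by norm_num)).comp_sub_right y
  rw [h1, ← integral_sub_right_eq_self (fun z : ℝ => (1 + |z|) ^ (-2 : ℝ)) y,
    ← integral_const_mul]
  refine norm_integral_le_of_norm_le (hInt.const_mul _) (Filter.Eventually.of_forall fun z => ?_)
  rw [h2, norm_mul]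
  have h3 := hq.norm_fourier_le_rpow hw (z - y)
  have hK0 : 0 ≤ K := by
    have := (norm_nonneg _).trans (hK z)
    by_contra h
    nlinarith [abs_nonneg (z - y)]
  calc _ ≤ ‖𝓕 (fun ξ => (q ξ : ℂ)) (z - y)‖ * (K * (1 + |z - y|)) := by gcongr; exact hK z
    _ = K * (‖𝓕 (fun ξ => (q ξ : ℂ)) (z - y)‖ * (1 + |z - y|)) := by ring
    _ ≤ K * (8 * (C * ∫ x, w x) * (1 + |z - y|) ^ (-2 : ℝ)) := by gcongr
    _ = _ := by ring

lemma DerivBound.norm_fourierInv_comp_mul_fourier_le {C K y s : ℝ} {w q : ℝ → ℝ}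
    (hq : DerivBound 3 C w q) (hw : Integrable w) {g : ℝ → ℂ} (hg : Integrable g)
    (hs : 0 < s) (hK : ∀ z, ‖g z‖ ≤ K * (1 + |z - y| / s)) :
    ‖𝓕⁻ (fun ξ => (q (s * ξ) : ℂ) * 𝓕 g ξ) y‖ ≤
      8 * (C * ∫ x, w x) * K * ∫ z : ℝ, (1 + |z|) ^ (-2 : ℝ) := by
  have hsC : (s : ℂ) ≠ 0 := by exact_mod_cast hs.ne'
  have h1 : (fun ξ => (q (s * ξ) : ℂ) * 𝓕 g ξ) = fun ξ =>
      (fun η : ℝ => (s : ℂ) * ((q η : ℂ) * 𝓕 (fun z => g (s * z)) η)) (s * ξ) := by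
    ext ξ
    simp only
    rw [fourier_comp_mul_left g hs, mul_div_cancel_left₀ _ hs.ne']
    field_simp
  rw [h1, fourierInv_comp_mul_left (fun η : ℝ =>
    (s : ℂ) * ((q η : ℂ) * 𝓕 (fun z => g (s * z)) η)) hs, fourierInv_const_mul,
    inv_mul_cancel_left₀ hsC]
  refine hq.norm_fourierInv_mul_fourier_le hw (hg.comp_mul_left' hs.ne') fun z => ?_
  refine (hK (s * z)).trans (le_of_eq ?_)
  congr 2
  rw [← abs_of_pos hs, ← abs_div, abs_of_pos hs]
  congr 1
  field_simp

lemma norm_fourierInv_mul_fourier_le_of_weighted {D y : ℝ} {q : ℝ → ℝ} {F : ℝ → ℂ} (hD : 0 ≤ D)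
    (hq : ∀ ξ, |q ξ| ≤ D * (1 + |ξ|) ^ (-(3 / 2) : ℝ)) (hq0 : ∀ ξ, |ξ| < 1 → q ξ = 0)
    (hFi : Integrable fun ξ => |ξ| * ‖𝓕 F ξ‖ ^ 2) (hF : ∫ ξ, |ξ| * ‖𝓕 F ξ‖ ^ 2 ≤ 1) :
    ‖𝓕⁻ (fun ξ => (q ξ : ℂ) * 𝓕 F ξ) y‖ ≤ D * ((∫ ξ : ℝ, (1 + |ξ|) ^ (-3 : ℝ)) + 1) := by
  have hInt := integrable_one_add_abs_rpow (r := 3) (by norm_num)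
  calc _ ≤ ∫ ξ : ℝ, D * ((1 + |ξ|) ^ (-3 : ℝ) + |ξ| * ‖𝓕 F ξ‖ ^ 2) := by
        refine norm_fourierInv_le_integral
          (w := fun ξ : ℝ => D * ((1 + |ξ|) ^ (-3 : ℝ) + |ξ| * ‖𝓕 F ξ‖ ^ 2))
          ((hInt.add hFi).const_mul D) (fun ξ => ?_) y
        rw [norm_mul, Complex.norm_real, Real.norm_eq_abs]
        rcases lt_or_ge |ξ| 1 with h | h
        · rw [hq0 ξ h]; simp; positivity
        · set A := ‖𝓕 F ξ‖
          have hA : 0 ≤ A := norm_nonneg _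
          have h3 : (1 + |ξ|) ^ (-3 : ℝ) = ((1 + |ξ|) ^ (-(3 / 2) : ℝ)) ^ 2 := by
            rw [← Real.rpow_natCast, ← Real.rpow_mul (by positivity)]; norm_num
          calc _ ≤ D * (1 + |ξ|) ^ (-(3 / 2) : ℝ) * A := by gcongr; exact hq ξ
            _ = D * ((1 + |ξ|) ^ (-(3 / 2) : ℝ) * A) := by ring
            _ ≤ _ := by
              gcongr
              rw [h3]
              nlinarith [sq_nonneg ((1 + |ξ|) ^ (-(3 / 2) : ℝ) - A), sq_nonneg A,
                sq_nonneg ((1 + |ξ|) ^ (-(3 / 2) : ℝ)), mul_le_mul_of_nonneg_right h (sq_nonneg A)]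
    _ = D * ((∫ ξ : ℝ, (1 + |ξ|) ^ (-3 : ℝ)) + ∫ ξ, |ξ| * ‖𝓕 F ξ‖ ^ 2) := by
        rw [integral_const_mul, integral_add hInt hFi]
    _ ≤ _ := by gcongr
/-- The restriction of `1 - χ` to positive frequencies. -/
def posHigh (χ : ℝ → ℝ) (ξ : ℝ) : ℝ := if 0 < ξ then 1 - χ ξ else 0

lemma posHigh_of_le_one {χ : ℝ → ℝ} (hχ : IsCutoff χ) {ξ : ℝ} (h : ξ ≤ 1) :
    posHigh χ ξ = 0 := by
  unfold posHigh
  split_ifs with h0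
  · rw [hχ.2.2.2.1 ξ ⟨by linarith, h⟩, sub_self]
  · rfl

lemma posHigh_of_two_lt {χ : ℝ → ℝ} (hχ : IsCutoff χ) {ξ : ℝ} (h : 2 < ξ) :
    posHigh χ ξ = 1 := by
  have : χ ξ = 0 := by
    by_contra hne
    exact absurd (hχ.2.2.2.2 hne).2 (not_le.2 h)
  rw [posHigh, if_pos (by linarith), this, sub_zero]

lemma SmoothBdd.posHigh {χ : ℝ → ℝ} (hχ : IsCutoff χ) : SmoothBdd (posHigh χ) := by
  have hz : ∀ x < 1, _root_.posHigh χ =ᶠ[nhds x] fun _ => 0 := fun x hx => by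
    filter_upwards [Iio_mem_nhds hx] with y hy using posHigh_of_le_one hχ (le_of_lt hy)
  have ho : ∀ x, 2 < x → _root_.posHigh χ =ᶠ[nhds x] fun _ => 1 := fun x hx => by
    filter_upwards [Ioi_mem_nhds hx] with y hy using posHigh_of_two_lt hχ hy
  refine .of_deriv_hasCompactSupport (C := 1) (contDiff_iff_contDiffAt.2 fun x => ?_)
    (fun x => ?_) (HasCompactSupport.intro (isCompact_Icc (a := (0 : ℝ)) (b := 2)) fun x hx => ?_)
  · rcases lt_or_ge x 1 with hx | hx
    · exact contDiffAt_const.congr_of_eventuallyEq (hz x hx)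
    · refine (contDiff_const.sub hχ.1).contDiffAt.congr_of_eventuallyEq (f := fun x => 1 - χ x) ?_
      filter_upwards [Ioi_mem_nhds (show (0 : ℝ) < x by linarith)] with y hy using if_pos hy
  · unfold _root_.posHigh
    have := hχ.2.2.1 x
    split_ifs
    · rw [abs_le]; constructor <;> linarith
    · simp
  · rw [mem_Icc, not_and_or, not_le, not_le] at hx
    rcases hx with hx | hx
    · rw [(hz x (by linarith)).deriv_eq, deriv_const]
    · rw [(ho x hx).deriv_eq, deriv_const]

/-- A smooth bump function localised near `1`. -/
def bumpOne : ContDiffBump (1 : ℝ) := ⟨1 / 4, 1 / 2, by norm_num, by norm_num⟩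

lemma bumpOne_of_near {x : ℝ} (h : |x - 1| ≤ 1 / 4) : bumpOne x = 1 :=
  bumpOne.one_of_mem_closedBall (by simpa [Real.dist_eq, bumpOne] using h)

lemma bumpOne_of_far {x : ℝ} (h : 1 / 2 ≤ |x - 1|) : bumpOne x = 0 :=
  bumpOne.zero_of_le_dist (by simpa [Real.dist_eq, bumpOne] using h)

lemma contDiff_bumpOne_sq : ContDiff ℝ (⊤ : ℕ∞) fun η : ℝ => bumpOne (η ^ 2) :=
  bumpOne.contDiff.comp (contDiff_id.pow 2)

lemma SmoothBdd.one_sub_bumpOne_sq : SmoothBdd fun η : ℝ => 1 - bumpOne (η ^ 2) := by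
  refine .of_deriv_hasCompactSupport (C := 1) (contDiff_const.sub contDiff_bumpOne_sq)
    (fun x => ?_) (HasCompactSupport.intro (isCompact_Icc (a := (-2 : ℝ)) (b := 2)) fun x hx => ?_)
  · have h0 := bumpOne.nonneg (x := x ^ 2)
    have h1 := bumpOne.le_one (x := x ^ 2)
    rw [abs_le]; constructor <;> linarith
  · have hx2 : 2 < x ^ 2 := by
      rw [mem_Icc, not_and_or, not_le, not_le] at hx
      rcases hx with hx | hx <;> nlinarith
    have : (fun η : ℝ => 1 - bumpOne (η ^ 2)) =ᶠ[nhds x] fun _ => 1 := by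
      filter_upwards [(continuous_pow 2).continuousAt.eventually (lt_mem_nhds hx2)] with y hy
      rw [bumpOne_of_far, sub_zero]
      exact le_abs.2 (Or.inl (by linarith))
    rw [this.deriv_eq, deriv_const]

/-- The hyperbolic cutoff `η^{-a}φ(η²)` on the positive half line. -/
def bumpRpow (a η : ℝ) : ℝ := if 0 < η then η ^ (-a) * bumpOne (η ^ 2) else 0

lemma exists_derivBound_bumpRpow (a : ℝ) {w : ℝ → ℝ} (hw : Continuous w) (hpos : ∀ x, 0 < w x)
    (n : ℕ) : ∃ C, 0 ≤ C ∧ DerivBound n C w (bumpRpow a) := by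
  have hz : ∀ x < 1 / 2, bumpRpow a x = 0 := fun x hx => by
    unfold bumpRpow
    split_ifs with h0
    · rw [bumpOne_of_far, mul_zero]
      exact le_abs.2 (Or.inr (by nlinarith))
    · rfl
  refine DerivBound.of_hasCompactSupport (contDiff_iff_contDiffAt.2 fun x => ?_)
    (HasCompactSupport.intro (isCompact_Icc (a := (0 : ℝ)) (b := 2)) fun x hx => ?_) hw hpos n
  · rcases lt_or_ge x (1 / 2) with hx | hx
    · refine (contDiffAt_const (c := (0 : ℝ))).congr_of_eventuallyEq ?_
      filter_upwards [Iio_mem_nhds hx] with y hy using hz y hy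
    · have h0 : 0 < x := by linarith
      refine ((contDiffAt_id.rpow_const_of_ne (p := -a) h0.ne').mul
        contDiff_bumpOne_sq.contDiffAt).congr_of_eventuallyEq ?_
      filter_upwards [Ioi_mem_nhds h0] with y hy using if_pos hy
  · rw [mem_Icc, not_and_or, not_le, not_le] at hx
    rcases hx with hx | hx
    · exact hz x (by linarith)
    · rw [bumpRpow, if_pos (by linarith), bumpOne_of_far, mul_zero]
      exact le_abs.2 (Or.inl (by nlinarith))
/-- The coefficient of `ξ²` in the symbol of `-3∂ₓ²`. -/
def symbolCoeff : ℝ := 12 * π ^ 2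

lemma symbolCoeff_pos : 0 < symbolCoeff := by unfold symbolCoeff; positivity

lemma one_le_symbolCoeff : 1 ≤ symbolCoeff := by
  unfold symbolCoeff; nlinarith [Real.pi_gt_three]

lemma exists_derivBound_quotient {χ : ℝ → ℝ} (hχ : IsCutoff χ) {a : ℝ} (ha : 1 ≤ a)
    (ha' : a ≤ 3 / 2) {D : ℝ} {R : ℝ → ℝ} (hD : 0 ≤ D)
    (hR : DerivBound 3 D (fun x => (1 + |x|)⁻¹) R) :
    ∃ C, 0 ≤ C ∧ ∀ σ s : ℝ, |σ| = 1 → 0 < s → s ≤ 1 →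
      DerivBound 3 (C * s ^ (a + 1 / 2)) (fun ξ => (1 + |ξ|) ^ (-(3 / 2) : ℝ))
        (fun ξ => symbolCoeff⁻¹ * s ^ 2 * (posHigh χ (σ * ξ) * (σ * ξ) ^ (-a) * R (s * ξ))) := by
  obtain ⟨C, hC0, hC⟩ := DerivBound.smoothBdd_mul_rpow (a := a) (by linarith) 3
    (SmoothBdd.posHigh hχ) (fun x hx => posHigh_of_le_one hχ hx.le) le_rfl
  refine ⟨2 ^ 3 * (C * D), by positivity, fun σ s hσ hs hs1 => ?_⟩
  refine (((hC.comp_mul hσ.le).mul (hR.comp_mul (s := s)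
    (by rwa [abs_of_pos hs]))).const_mul (symbolCoeff⁻¹ * s ^ 2)).mono fun ξ => ?_
  have hk : 0 < symbolCoeff⁻¹ := inv_pos.2 symbolCoeff_pos
  have hk1 : symbolCoeff⁻¹ ≤ 1 := inv_le_one_of_one_le₀ one_le_symbolCoeff
  rw [abs_mul σ, hσ, one_mul, abs_of_pos (show 0 < symbolCoeff⁻¹ * s ^ 2 by positivity)]
  have hX : 1 ≤ 1 + |s * ξ| := by linarith [abs_nonneg (s * ξ)]
  have h1 : (1 + |s * ξ|)⁻¹ ≤ s ^ (a - 3 / 2) * (1 + |ξ|) ^ (a - 3 / 2) := by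
    rw [← Real.mul_rpow hs.le (by positivity)]
    calc (1 + |s * ξ|)⁻¹ = (1 + |s * ξ|) ^ (-1 : ℝ) := (Real.rpow_neg_one _).symm
      _ ≤ (1 + |s * ξ|) ^ (a - 3 / 2) := Real.rpow_le_rpow_of_exponent_le hX (by linarith)
      _ ≤ _ := Real.rpow_le_rpow_of_nonpos (by positivity)
        (by rw [abs_mul, abs_of_pos hs, mul_add, mul_one]; linarith) (by linarith)
  have h2 : s ^ (a + 1 / 2) = s ^ 2 * s ^ (a - 3 / 2) := by
    rw [← Real.rpow_natCast, ← Real.rpow_add hs]; congr 1; push_cast; ring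
  have h3 : (1 + |ξ|) ^ (-(3 / 2) : ℝ) = (1 + |ξ|) ^ (-a) * (1 + |ξ|) ^ (a - 3 / 2) := by
    rw [← Real.rpow_add (by positivity)]; congr 1; ring
  rw [h2, h3]
  calc _ ≤ 1 * s ^ 2 * (2 ^ 3 * (C * D)) *
        ((1 + |ξ|) ^ (-a) * (s ^ (a - 3 / 2) * (1 + |ξ|) ^ (a - 3 / 2))) := by gcongr
    _ = _ := by ring

lemma SchwartzMap.fourier_deriv_deriv (v : 𝓢(ℝ, ℂ)) (ξ : ℝ) :
    𝓕 (derivCLM ℂ ℂ (derivCLM ℂ ℂ v) : ℝ → ℂ) ξ = -(2 * π * ξ) ^ 2 * 𝓕 (v : ℝ → ℂ) ξ := by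
  have key : ∀ f : 𝓢(ℝ, ℂ), 𝓕 (derivCLM ℂ ℂ f : ℝ → ℂ) ξ
      = (2 * π * Complex.I * ξ) * 𝓕 (f : ℝ → ℂ) ξ := fun f => by
    have := Real.fourier_deriv f.integrable f.differentiable (derivCLM ℂ ℂ f).integrable
    exact congrFun this ξ
  rw [key, key]
  linear_combination (2 * π * ξ : ℂ) ^ 2 * 𝓕 (v : ℝ → ℂ) ξ * Complex.I_sq

/-- The constant in the bound for multipliers factoring through the symbol `κξ² + p`. -/
def symbolBound : ℝ :=
  ((∫ ξ : ℝ, (1 + |ξ|) ^ (-3 : ℝ)) + 1) +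
    8 * (∫ ξ : ℝ, (1 + |ξ|) ^ (-(3 / 2) : ℝ)) * (9 + 32 * symbolCoeff) *
      ∫ z : ℝ, (1 + |z|) ^ (-2 : ℝ)

lemma symbolBound_nonneg : 0 ≤ symbolBound := by
  have h : ∀ r : ℝ, 0 ≤ ∫ ξ : ℝ, (1 + |ξ|) ^ r := fun r =>
    integral_nonneg fun ξ => by positivity
  have := symbolCoeff_pos
  have h1 := h (-3)
  have h2 := h (-(3 / 2))
  have h3 := h (-2)
  unfold symbolBound
  positivity

lemma norm_fourierInv_mul_symbol_le {D p y : ℝ} {q : ℝ → ℝ} (hD : 0 ≤ D)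
    (hq : DerivBound 3 D (fun ξ => (1 + |ξ|) ^ (-(3 / 2) : ℝ)) q)
    (hq0 : ∀ ξ, |ξ| < 1 → q ξ = 0) {v F : 𝓢(ℝ, ℂ)} (hv : ∀ z, ‖v z‖ ≤ 1)
    (hvF : ∀ z : ℝ, ‖F z - z * v z + 3 * derivCLM ℂ ℂ (derivCLM ℂ ℂ v) z‖ ≤ 9)
    (hF : ∫ ξ, |ξ| * ‖𝓕 (F : ℝ → ℂ) ξ‖ ^ 2 ≤ 1)
    (hFi : Integrable fun ξ => |ξ| * ‖𝓕 (F : ℝ → ℂ) ξ‖ ^ 2)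
    (hp : |y - p| ≤ 32 * symbolCoeff) :
    ‖𝓕⁻ (fun ξ : ℝ => ((q ξ * (symbolCoeff * ξ ^ 2 + p) : ℝ) : ℂ) * 𝓕 (v : ℝ → ℂ) ξ) y‖
      ≤ D * symbolBound := by
  set v2 := derivCLM ℂ ℂ (derivCLM ℂ ℂ v) with hv2
  set g : 𝓢(ℝ, ℂ) := F + (-p : ℂ) • v + (3 : ℂ) • v2 with hg
  have hw := integrable_one_add_abs_rpow (r := 3 / 2) (by norm_num)
  have hFg : ∀ ξ, 𝓕 (g : ℝ → ℂ) ξ = 𝓕 (F : ℝ → ℂ) ξ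
      - ((symbolCoeff * ξ ^ 2 + p : ℝ) : ℂ) * 𝓕 (v : ℝ → ℂ) ξ := fun ξ => by
    have h1 : 𝓕 g ξ = 𝓕 F ξ + (-p : ℂ) * 𝓕 v ξ + 3 * 𝓕 v2 ξ := by
      rw [hg, FourierTransform.fourier_add, FourierTransform.fourier_add,
        FourierTransform.fourier_smul, FourierTransform.fourier_smul]
      rfl
    simp only [SchwartzMap.fourier_coe] at h1
    rw [h1, hv2, SchwartzMap.fourier_deriv_deriv]
    unfold symbolCoeff
    push_cast
    ring
  have hqc : Continuous fun ξ => (q ξ : ℂ) := Complex.continuous_ofReal.comp hq.continuous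
  have hInt : ∀ f : 𝓢(ℝ, ℂ), Integrable fun ξ => (q ξ : ℂ) * 𝓕 (f : ℝ → ℂ) ξ := fun f => by
    have := (𝓕 f).integrable (μ := volume)
    rw [SchwartzMap.fourier_coe] at this
    refine this.bdd_mul (c := D * 1) hqc.aestronglyMeasurable
      (Filter.Eventually.of_forall fun ξ => ?_)
    rw [Complex.norm_real]
    refine (hq.bound ξ).trans ?_
    gcongr
    exact Real.rpow_le_one_of_one_le_of_nonpos (by linarith [abs_nonneg ξ]) (by norm_num)
  have hsplit : (fun ξ : ℝ => ((q ξ * (symbolCoeff * ξ ^ 2 + p) : ℝ) : ℂ) * 𝓕 (v : ℝ → ℂ) ξ)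
      = fun ξ => (q ξ : ℂ) * 𝓕 (F : ℝ → ℂ) ξ - (q ξ : ℂ) * 𝓕 (g : ℝ → ℂ) ξ := by
    ext ξ
    rw [hFg, Complex.ofReal_mul]
    ring
  have hgb : ∀ z, ‖g z‖ ≤ (9 + 32 * symbolCoeff) * (1 + |z - y|) := fun z => by
    have h1 : g z = (F z - z * v z + 3 * v2 z) + ((z - p : ℝ) : ℂ) * v z := by
      rw [hg]
      simp
      ring
    have h2 : |z - p| ≤ |z - y| + 32 * symbolCoeff :=
      (abs_sub_le z y p).trans (by linarith)
    rw [h1]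
    refine (norm_add_le _ _).trans ?_
    rw [norm_mul, Complex.norm_real, Real.norm_eq_abs]
    have h3 : |z - p| * ‖v z‖ ≤ |z - p| := mul_le_of_le_one_right (abs_nonneg _) (hv z)
    nlinarith [hvF z, abs_nonneg (z - y), symbolCoeff_pos,
      mul_nonneg symbolCoeff_pos.le (abs_nonneg (z - y))]
  rw [hsplit, fourierInv_sub_apply (hInt F) (hInt g)]
  refine (norm_sub_le _ _).trans ?_
  have h1 := norm_fourierInv_mul_fourier_le_of_weighted (y := y) hD hq.bound hq0 hFi hF
  have h2 := hq.norm_fourierInv_mul_fourier_le hw g.integrable hgb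
  refine (add_le_add h1 h2).trans (le_of_eq ?_)
  unfold symbolBound
  ring
lemma norm_le_one_of_decay {v : ℝ → ℂ} (hv : ∀ z, ‖v z‖ ≤ (1 + z ^ 2) ^ (-(1 / 8) : ℝ)) (z : ℝ) :
    ‖v z‖ ≤ 1 :=
  (hv z).trans (Real.rpow_le_one_of_one_le_of_nonpos (by nlinarith [sq_nonneg z]) (by norm_num))

lemma quotient_mul_symbol {s ξ g p σ : ℝ} (hs : 0 < s) (hp : p = σ * (symbolCoeff / s ^ 2))
    {r : ℝ} : symbolCoeff⁻¹ * s ^ 2 * (g * r) * (symbolCoeff * ξ ^ 2 + p)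
      = g * (r * ((s * ξ) ^ 2 + σ)) := by
  have := symbolCoeff_pos.ne'
  rw [hp]
  field_simp

lemma posHigh_mul_eq_zero {χ : ℝ → ℝ} (hχ : IsCutoff χ) {σ ξ : ℝ} (hσ : |σ| = 1) (h : |ξ| < 1) :
    posHigh χ (σ * ξ) = 0 := by
  refine posHigh_of_le_one hχ ((le_abs_self _).trans ?_)
  rw [abs_mul, hσ, one_mul]
  exact h.le

lemma exists_norm_le_elliptic {χ : ℝ → ℝ} (hχ : IsCutoff χ) {a : ℝ} (ha : 1 ≤ a)
    (ha' : a ≤ 3 / 2) : ∃ C, 0 ≤ C ∧ ∀ v F : 𝓢(ℝ, ℂ), (∀ z, ‖v z‖ ≤ 1) →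
      (∀ z : ℝ, ‖F z - z * v z + 3 * derivCLM ℂ ℂ (derivCLM ℂ ℂ v) z‖ ≤ 9) →
      ∫ ξ, |ξ| * ‖𝓕 (F : ℝ → ℂ) ξ‖ ^ 2 ≤ 1 →
      (Integrable fun ξ => |ξ| * ‖𝓕 (F : ℝ → ℂ) ξ‖ ^ 2) →
      ∀ σ s y : ℝ, |σ| = 1 → 0 < s → s ≤ 1 →
        |y - symbolCoeff / s ^ 2| ≤ 32 * symbolCoeff →
        ‖𝓕⁻ (fun ξ : ℝ => ((posHigh χ (σ * ξ) * (σ * ξ) ^ (-a) : ℝ) : ℂ) * 𝓕 (v : ℝ → ℂ) ξ) y‖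
          ≤ C * s ^ (a + 1 / 2) := by
  have h1 : SmoothBdd fun _ : ℝ => 1 := by
    refine .of_deriv_hasCompactSupport (C := 1) contDiff_const (by simp) ?_
    simpa using HasCompactSupport.intro (f := fun _ : ℝ => (0 : ℝ)) isCompact_empty (by simp)
  obtain ⟨D, hD0, hD⟩ := DerivBound.smoothBdd_mul_pow_mul_inv (σ := 1) (by simp) 3 h1
    (fun x hx => by
      have := le_abs_self (x ^ 2 + 1)
      nlinarith [sq_nonneg x]) (i := 1) (j := 0) (by norm_num)
  obtain ⟨C, hC0, hC⟩ := exists_derivBound_quotient hχ ha ha' hD0 hD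
  refine ⟨C * symbolBound, mul_nonneg hC0 symbolBound_nonneg,
    fun v F hv hvF hF hFi σ s y hσ hs hs1 hy => ?_⟩
  have := norm_fourierInv_mul_symbol_le (by positivity) (hC σ s hσ hs hs1)
    (fun ξ hξ => by simp [posHigh_mul_eq_zero hχ hσ hξ]) hv hvF hF hFi hy
  rw [mul_right_comm]
  convert this using 3
  ext ξ
  congr 2
  rw [quotient_mul_symbol (σ := 1) hs (by ring), pow_zero, one_mul, one_mul, pow_one,
    inv_mul_cancel₀ (by positivity), mul_one]

lemma posHigh_mul_bumpOne {χ : ℝ → ℝ} (hχ : IsCutoff χ) {a σ s ξ : ℝ} (hσ : |σ| = 1)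
    (hs : 0 < s) (hs1 : s ≤ 1 / 4) :
    posHigh χ (σ * ξ) * (σ * ξ) ^ (-a) * bumpOne ((s * ξ) ^ 2)
      = s ^ a * bumpRpow a (σ * (s * ξ)) := by
  have hsq : (s * ξ) ^ 2 = (s * (σ * ξ)) ^ 2 := by
    have : σ ^ 2 = 1 := by rw [← sq_abs, hσ, one_pow]
    rw [mul_pow s (σ * ξ), mul_pow σ, this]; ring
  rw [hsq, mul_left_comm σ s ξ]
  generalize σ * ξ = ζ
  unfold bumpRpow
  rcases le_or_gt ζ 0 with h0 | h0
  · rw [posHigh_of_le_one hχ (by linarith), if_neg (not_lt.2 (by nlinarith))]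
    simp
  · rw [if_pos (by positivity)]
    rcases le_or_gt (1 / 2) |(s * ζ) ^ 2 - 1| with h | h
    · rw [bumpOne_of_far h]; simp
    · have h2 : 1 / 2 < (s * ζ) ^ 2 := by have := (abs_lt.1 h).1; linarith
      have h3 : 2 < ζ := by
        by_contra hle
        have : s * ζ ≤ 1 / 4 * 2 := mul_le_mul hs1 (not_lt.1 hle) h0.le (by norm_num)
        nlinarith [mul_pos hs h0]
      rw [posHigh_of_two_lt hχ h3, Real.mul_rpow hs.le h0.le, Real.rpow_neg hs.le]
      have := (Real.rpow_pos_of_pos hs a).ne'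
      field_simp

lemma rpow_neg_eighth_peetre (y z : ℝ) : (1 + z ^ 2) ^ (-(1 / 8) : ℝ) ≤
    2 * (1 + y ^ 2) ^ (-(1 / 8) : ℝ) * (1 + |z - y|) := by
  set m := 2 * (1 + |z - y|) with hm
  have hz := abs_nonneg (z - y)
  have hm2 : 2 ≤ m := by linarith
  have h1 : 1 + y ^ 2 ≤ m ^ 8 * (1 + z ^ 2) := by
    have h2 : 1 + y ^ 2 ≤ m ^ 2 * (1 + z ^ 2) := by
      have : m ^ 2 = 4 * (1 + 2 * |z - y| + (z - y) ^ 2) := by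
        rw [hm, ← sq_abs (z - y)]; ring
      have h3 : 2 * (1 + (z - y) ^ 2) ≤ m ^ 2 := by nlinarith [sq_nonneg (z - y)]
      have h4 : 1 + y ^ 2 ≤ 2 * (1 + (z - y) ^ 2) * (1 + z ^ 2) := by
        nlinarith [sq_nonneg (2 * z - y), sq_nonneg (z * (z - y)), sq_nonneg (z - y), sq_nonneg z]
      exact h4.trans (by gcongr)
    refine h2.trans ?_
    gcongr
    · linarith
    · norm_num
  have h8 : (m ^ 8) ^ (-(1 / 8) : ℝ) = m⁻¹ := by
    rw [← Real.rpow_natCast, ← Real.rpow_mul (by linarith)]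
    norm_num
    exact Real.rpow_neg_one m
  have h5 := Real.rpow_le_rpow_of_nonpos (z := -(1 / 8)) (by positivity) h1 (by norm_num)
  rw [Real.mul_rpow (by positivity) (by positivity), h8, inv_mul_le_iff₀ (by linarith)] at h5
  refine h5.trans (le_of_eq ?_)
  ring

lemma exists_norm_le_hyperbolic {χ : ℝ → ℝ} (hχ : IsCutoff χ) {a : ℝ} (ha : 1 ≤ a)
    (ha' : a ≤ 3 / 2) : ∃ C, 0 ≤ C ∧ ∀ v F : 𝓢(ℝ, ℂ),
      (∀ z, ‖v z‖ ≤ (1 + z ^ 2) ^ (-(1 / 8) : ℝ)) →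
      (∀ z : ℝ, ‖F z - z * v z + 3 * derivCLM ℂ ℂ (derivCLM ℂ ℂ v) z‖ ≤ 9) →
      ∫ ξ, |ξ| * ‖𝓕 (F : ℝ → ℂ) ξ‖ ^ 2 ≤ 1 →
      (Integrable fun ξ => |ξ| * ‖𝓕 (F : ℝ → ℂ) ξ‖ ^ 2) →
      ∀ σ s y : ℝ, |σ| = 1 → 0 < s → s ≤ 1 / 4 → y = -(symbolCoeff / s ^ 2) →
        ‖𝓕⁻ (fun ξ : ℝ => ((posHigh χ (σ * ξ) * (σ * ξ) ^ (-a) : ℝ) : ℂ) * 𝓕 (v : ℝ → ℂ) ξ) y‖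
          ≤ C * (s ^ (a + 1 / 2) + s ^ a * (1 + y ^ 2) ^ (-(1 / 8) : ℝ)) := by
  obtain ⟨D, hD0, hD⟩ := DerivBound.smoothBdd_mul_pow_mul_inv (σ := -1) (by simp) 3
    SmoothBdd.one_sub_bumpOne_sq (fun x hx => by
      rw [bumpOne_of_near (by simpa [sub_eq_add_neg] using hx.le), sub_self])
      (i := 1) (j := 0) (by norm_num)
  obtain ⟨C, hC0, hC⟩ := exists_derivBound_quotient hχ ha ha' hD0 hD
  obtain ⟨E, hE0, hE⟩ := exists_derivBound_bumpRpow a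
    (w := fun x : ℝ => (1 + |x|) ^ (-2 : ℝ))
    ((continuous_const.add continuous_abs).rpow_const fun x =>
      Or.inl (by have := abs_nonneg x; simp; linarith))
    (fun x => by positivity) 3
  have hw := integrable_one_add_abs_rpow (r := 2) (by norm_num)
  set J := ∫ z : ℝ, (1 + |z|) ^ (-2 : ℝ)
  have hJ : 0 ≤ J := integral_nonneg fun ξ => by positivity
  have hS := symbolBound_nonneg
  refine ⟨C * symbolBound + 8 * (E * J) * 2 * J, by positivity,
    fun v F hv hvF hF hFi σ s y hσ hs hs1 hy => ?_⟩
  set q : ℝ → ℝ := fun ξ => symbolCoeff⁻¹ * s ^ 2 * (posHigh χ (σ * ξ) * (σ * ξ) ^ (-a) *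
    ((1 - bumpOne ((s * ξ) ^ 2)) * ((s * ξ) ^ 0 * (((s * ξ) ^ 2 + -1)⁻¹) ^ 1))) with hq
  have hqD : DerivBound 3 (C * s ^ (a + 1 / 2)) (fun ξ => (1 + |ξ|) ^ (-(3 / 2) : ℝ)) q :=
    hC σ s hσ hs (by linarith)
  have hB := norm_fourierInv_mul_symbol_le (y := y) (p := y) (by positivity) hqD
    (fun ξ hξ => by simp [hq, posHigh_mul_eq_zero hχ hσ hξ]) (norm_le_one_of_decay hv) hvF hF hFi
    (by have := symbolCoeff_pos; simp; positivity)
  have hEσ : DerivBound 3 E (fun x : ℝ => (1 + |x|) ^ (-2 : ℝ)) fun x => bumpRpow a (σ * x) := by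
    have := hE.comp_mul hσ.le
    simpa only [abs_mul, hσ, one_mul] using this
  have hA := hEσ.norm_fourierInv_comp_mul_fourier_le (y := y) (s := s)
    (K := 2 * (1 + y ^ 2) ^ (-(1 / 8) : ℝ)) hw v.integrable hs fun z => by
      refine (hv z).trans ((rpow_neg_eighth_peetre y z).trans ?_)
      gcongr
      exact le_div_self (abs_nonneg _) hs (by linarith)
  set G : ℝ → ℂ := fun ξ => ((posHigh χ (σ * ξ) * (σ * ξ) ^ (-a) : ℝ) : ℂ) * 𝓕 (v : ℝ → ℂ) ξ
    with hG
  set S : ℝ → ℂ := fun ξ =>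
    ((s ^ a : ℝ) : ℂ) * ((bumpRpow a (σ * (s * ξ)) : ℂ) * 𝓕 (v : ℝ → ℂ) ξ) with hSdef
  have hsplit : (fun ξ : ℝ => ((q ξ * (symbolCoeff * ξ ^ 2 + y) : ℝ) : ℂ) * 𝓕 (v : ℝ → ℂ) ξ)
      = fun ξ => G ξ - S ξ := by
    ext ξ
    simp only [hG, hSdef]
    rw [← mul_assoc, ← sub_mul, ← Complex.ofReal_mul, ← Complex.ofReal_sub]
    congr 2
    rw [← posHigh_mul_bumpOne hχ hσ hs hs1, hq]
    simp only
    rw [quotient_mul_symbol (σ := -1) hs (by rw [hy]; ring), pow_zero, one_mul, pow_one,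
      ← mul_one_sub, mul_assoc (1 - bumpOne ((s * ξ) ^ 2))]
    rcases eq_or_ne ((s * ξ) ^ 2 + -1) 0 with h0 | h0
    · rw [bumpOne_of_near (by rw [← sub_eq_add_neg] at h0; rw [h0]; norm_num)]
      simp
    · rw [inv_mul_cancel₀ h0, mul_one]
  have hInt : ∀ {c : ℝ → ℝ} {A : ℝ}, Continuous c → (∀ ξ, |c ξ| ≤ A) →
      Integrable fun ξ => (c ξ : ℂ) * 𝓕 (v : ℝ → ℂ) ξ := fun {c A} hc hA => by
    have := (𝓕 v).integrable (μ := volume)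
    rw [SchwartzMap.fourier_coe] at this
    exact this.bdd_mul (c := A) (Complex.continuous_ofReal.comp hc).aestronglyMeasurable
      (Filter.Eventually.of_forall fun ξ => by rw [Complex.norm_real]; exact hA ξ)
  have hSi : Integrable S := by
    have h1 := hEσ.comp_mul (s := s) (by rw [abs_of_pos hs]; linarith)
    refine (hInt h1.continuous (A := E * 1) fun ξ => (h1.bound ξ).trans ?_).const_mul _
    gcongr
    exact Real.rpow_le_one_of_one_le_of_nonpos (by linarith [abs_nonneg (s * ξ)]) (by norm_num)
  have hGi : Integrable G := by
    obtain ⟨B, hB0, hB⟩ := DerivBound.smoothBdd_mul_rpow (a := a) (by linarith) 0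
      (SmoothBdd.posHigh hχ) (fun x hx => posHigh_of_le_one hχ hx.le) le_rfl
    have h1 := hB.comp_mul hσ.le
    refine hInt h1.continuous (A := B * 1) fun ξ => (h1.bound ξ).trans ?_
    gcongr
    exact Real.rpow_le_one_of_one_le_of_nonpos (by linarith [abs_nonneg (σ * ξ)]) (by linarith)
  rw [hsplit, fourierInv_sub_apply hGi hSi] at hB
  have hSb : ‖𝓕⁻ S y‖ ≤ s ^ a * (8 * (E * J) * (2 * (1 + y ^ 2) ^ (-(1 / 8) : ℝ)) * J) := by
    rw [hSdef, fourierInv_const_mul, norm_mul, Complex.norm_real, Real.norm_eq_abs,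
      abs_of_pos (Real.rpow_pos_of_pos hs a)]
    gcongr
  have h1 : 0 ≤ s ^ (a + 1 / 2) := by positivity
  have h2 : 0 ≤ s ^ a * (1 + y ^ 2) ^ (-(1 / 8) : ℝ) := by positivity
  calc ‖𝓕⁻ G y‖ = ‖(𝓕⁻ G y - 𝓕⁻ S y) + 𝓕⁻ S y‖ := by rw [sub_add_cancel]
    _ ≤ C * s ^ (a + 1 / 2) * symbolBound +
        s ^ a * (8 * (E * J) * (2 * (1 + y ^ 2) ^ (-(1 / 8) : ℝ)) * J) :=
      (norm_add_le _ _).trans (add_le_add hB hSb)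
    _ = C * symbolBound * s ^ (a + 1 / 2) +
        8 * (E * J) * 2 * J * (s ^ a * (1 + y ^ 2) ^ (-(1 / 8) : ℝ)) := by ring
    _ ≤ _ := by
      have h3 : 0 ≤ C * symbolBound := by positivity
      have h4 : 0 ≤ 8 * (E * J) * 2 * J := by positivity
      nlinarith [mul_nonneg h3 h2, mul_nonneg h4 h1]

lemma rpow_two_mul_le_of_le_div {κ s y r : ℝ} (hr : 0 ≤ r) (hs : 0 < s)
    (h : 1 + |y| ≤ 2 * (κ / s ^ 2)) :
    s ^ (2 * r) ≤ (2 * κ) ^ r * (1 + y ^ 2) ^ (-(r / 2)) := by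
  have h1 : s ^ 2 * (1 + y ^ 2) ^ (1 / 2 : ℝ) ≤ 2 * κ := by
    have h2 : (1 + y ^ 2) ^ (1 / 2 : ℝ) ≤ 1 + |y| := by
      rw [← Real.sqrt_eq_rpow]
      refine Real.sqrt_le_iff.2 ⟨by positivity, ?_⟩
      rw [add_sq, sq_abs]
      linarith [abs_nonneg y]
    have h3 := mul_le_mul_of_nonneg_left (h2.trans h) (sq_nonneg s)
    refine h3.trans (le_of_eq ?_)
    field_simp
  have h4 := Real.rpow_le_rpow (by positivity) h1 hr
  rw [Real.mul_rpow (by positivity) (by positivity), ← Real.rpow_mul (by positivity),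
    ← Real.rpow_natCast s, ← Real.rpow_mul hs.le] at h4
  rw [Real.rpow_neg (by positivity), ← div_eq_mul_inv, le_div_iff₀ (by positivity)]
  rwa [Nat.cast_ofNat, one_div_mul_eq_div] at h4

lemma exists_norm_fourierInv_posHigh_le {χ : ℝ → ℝ} (hχ : IsCutoff χ) {a : ℝ} (ha : 1 ≤ a)
    (ha' : a ≤ 3 / 2) : ∃ C, 0 ≤ C ∧ ∀ v F : 𝓢(ℝ, ℂ),
      (∀ z, ‖v z‖ ≤ (1 + z ^ 2) ^ (-(1 / 8) : ℝ)) →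
      (∀ z : ℝ, ‖F z - z * v z + 3 * derivCLM ℂ ℂ (derivCLM ℂ ℂ v) z‖ ≤ 9) →
      ∫ ξ, |ξ| * ‖𝓕 (F : ℝ → ℂ) ξ‖ ^ 2 ≤ 1 →
      (Integrable fun ξ => |ξ| * ‖𝓕 (F : ℝ → ℂ) ξ‖ ^ 2) →
      ∀ σ y : ℝ, |σ| = 1 →
        ‖𝓕⁻ (fun ξ : ℝ => ((posHigh χ (σ * ξ) * (σ * ξ) ^ (-a) : ℝ) : ℂ) * 𝓕 (v : ℝ → ℂ) ξ) y‖
          ≤ C * (1 + y ^ 2) ^ (-(a / 4 + 1 / 8)) := by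
  obtain ⟨A, hA0, hA⟩ := exists_norm_le_elliptic hχ ha ha'
  obtain ⟨B, hB0, hB⟩ := exists_norm_le_hyperbolic hχ ha ha'
  have hκ := symbolCoeff_pos
  have hκ1 := one_le_symbolCoeff
  set κ := symbolCoeff
  refine ⟨A * (2 * κ) ^ (a / 2 + 1 / 4) + B * ((2 * κ) ^ (a / 2 + 1 / 4) + (2 * κ) ^ (a / 2)),
    by positivity, fun v F hv hvF hF hFi σ y hσ => ?_⟩
  have hE : ∀ s, 0 < s → 1 + |y| ≤ 2 * (κ / s ^ 2) → s ^ (a + 1 / 2) ≤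
      (2 * κ) ^ (a / 2 + 1 / 4) * (1 + y ^ 2) ^ (-(a / 4 + 1 / 8)) := fun s hs h => by
    have := rpow_two_mul_le_of_le_div (r := a / 2 + 1 / 4) (by linarith) hs h
    convert this using 3 <;> ring
  have hH : ∀ s, 0 < s → 1 + |y| ≤ 2 * (κ / s ^ 2) → s ^ a * (1 + y ^ 2) ^ (-(1 / 8) : ℝ) ≤
      (2 * κ) ^ (a / 2) * (1 + y ^ 2) ^ (-(a / 4 + 1 / 8)) := fun s hs h => by
    have := rpow_two_mul_le_of_le_div (r := a / 2) (by linarith) hs h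
    rw [mul_div_cancel₀ _ (two_ne_zero)] at this
    calc _ ≤ (2 * κ) ^ (a / 2) * (1 + y ^ 2) ^ (-(a / 2 / 2)) * (1 + y ^ 2) ^ (-(1 / 8) : ℝ) := by
          gcongr
      _ = _ := by
        rw [mul_assoc, ← Real.rpow_add (by positivity)]; congr 2; ring
  have hs : ∀ p : ℝ, 16 * κ ≤ p → ∃ s, 0 < s ∧ s ≤ 1 / 4 ∧ κ / s ^ 2 = p := fun p hp => by
    have hp0 : 0 < p := by linarith
    have hsq : √(κ / p) ^ 2 = κ / p := Real.sq_sqrt (by positivity)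
    refine ⟨√(κ / p), by positivity, ?_, ?_⟩
    · refine Real.sqrt_le_iff.2 ⟨by norm_num, ?_⟩
      rw [div_le_iff₀ hp0]
      linarith
    · rw [hsq]; field_simp
  have hY : 0 < (1 + y ^ 2) ^ (-(a / 4 + 1 / 8)) := by positivity
  rcases lt_or_ge y (-(16 * κ)) with hy | hy
  · obtain ⟨s, hs0, hs1, hsp⟩ := hs (-y) (by linarith)
    have hyp : 1 + |y| ≤ 2 * (κ / s ^ 2) := by
      rw [hsp, abs_of_neg (by linarith)]; linarith
    refine (hB v F hv hvF hF hFi σ s y hσ hs0 hs1 (by rw [hsp, neg_neg])).trans ?_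
    calc _ ≤ B * ((2 * κ) ^ (a / 2 + 1 / 4) * (1 + y ^ 2) ^ (-(a / 4 + 1 / 8)) +
          (2 * κ) ^ (a / 2) * (1 + y ^ 2) ^ (-(a / 4 + 1 / 8))) :=
          mul_le_mul_of_nonneg_left (add_le_add (hE s hs0 hyp) (hH s hs0 hyp)) hB0
      _ = B * ((2 * κ) ^ (a / 2 + 1 / 4) + (2 * κ) ^ (a / 2)) *
          (1 + y ^ 2) ^ (-(a / 4 + 1 / 8)) := by ring
      _ ≤ _ := by gcongr; exact le_add_of_nonneg_left (by positivity)
  · obtain ⟨s, hs0, hs1, hsp⟩ := hs (y + 32 * κ) (by linarith)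
    have hyp : 1 + |y| ≤ 2 * (κ / s ^ 2) := by
      rw [hsp]
      rcases abs_cases y with h | h <;> linarith
    refine (hA v F (norm_le_one_of_decay hv) hvF hF hFi σ s y hσ hs0 (by linarith)
      (by rw [hsp, sub_add_cancel_left, abs_neg, abs_of_pos (by positivity)])).trans ?_
    calc _ ≤ A * ((2 * κ) ^ (a / 2 + 1 / 4) * (1 + y ^ 2) ^ (-(a / 4 + 1 / 8))) := by
          gcongr
          exact hE s hs0 hyp
      _ = A * (2 * κ) ^ (a / 2 + 1 / 4) * (1 + y ^ 2) ^ (-(a / 4 + 1 / 8)) := by ring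
      _ ≤ _ := by gcongr; exact le_add_of_nonneg_right (by positivity)
lemma SmoothBdd.hasTemperateGrowth {f : ℝ → ℝ} (hf : SmoothBdd f) :
    Function.HasTemperateGrowth f := by
  refine ⟨hf.1, fun n => ?_⟩
  obtain ⟨C, hC⟩ := hf.2 n
  exact ⟨0, C, fun x => by
    rw [norm_iteratedFDeriv_eq_norm_iteratedDeriv, pow_zero, mul_one]; exact hC x⟩

lemma SchwartzMap.exists_comp_mul (f : 𝓢(ℝ, ℂ)) {c : ℝ} (hc : c ≠ 0) :
    ∃ g : 𝓢(ℝ, ℂ), ∀ x, g x = f (c * x) :=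
  ⟨compCLMOfContinuousLinearEquiv ℂ (ContinuousLinearEquiv.unitsEquivAut ℝ (Units.mk0 c hc)) f,
    fun x => by simp [mul_comm]⟩

lemma SchwartzMap.exists_ofReal_comp_mul (f : 𝓢(ℝ, ℝ)) (b : ℝ) {c : ℝ} (hc : c ≠ 0) :
    ∃ g : 𝓢(ℝ, ℂ), ∀ x, g x = ((b * f (c * x) : ℝ) : ℂ) := by
  obtain ⟨g, hg⟩ := (((b • f).postcompCLM Complex.ofRealCLM)).exists_comp_mul hc
  exact ⟨g, fun x => by rw [hg]; simp⟩

lemma SchwartzMap.exists_eq_LNL (t : ℝ) (u : 𝓢(ℝ, ℝ)) : ∃ L : 𝓢(ℝ, ℝ), ∀ x, L x = LNL t u x := by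
  refine ⟨smulLeftCLM ℝ (fun x : ℝ => x) u - (3 * t) • derivCLM ℝ ℝ (derivCLM ℝ ℝ u)
    + (9 * t) • smulLeftCLM ℝ u u, fun x => ?_⟩
  have h1 := smulLeftCLM_apply_apply (F := ℝ) Function.HasTemperateGrowth.id' u x
  have h2 := smulLeftCLM_apply_apply (F := ℝ) u.hasTemperateGrowth u x
  have h3 : derivCLM ℝ ℝ (derivCLM ℝ ℝ u) x = iteratedDeriv 2 u x := by
    rw [iteratedDeriv_succ, iteratedDeriv_one]; rfl
  simp only [add_apply, sub_apply, smul_apply, smul_eq_mul] at *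
  rw [h1, h2, h3, LNL]
  ring

lemma SchwartzMap.integrable_abs_mul_norm_sq (f : 𝓢(ℝ, ℂ)) :
    Integrable fun ξ : ℝ => |ξ| * ‖f ξ‖ ^ 2 := by
  have h := f.integrable_pow_mul volume 1
  obtain ⟨C, hC⟩ := f.decay 0 0
  have hb : ∀ ξ, ‖f ξ‖ ≤ C := by simpa using hC.2
  refine (h.mul_const C).mono' (by fun_prop) (Filter.Eventually.of_forall fun ξ => ?_)
  rw [Real.norm_of_nonneg (by positivity), pow_one, sq, ← mul_assoc, Real.norm_eq_abs]
  gcongr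
  exact hb ξ

lemma deriv_deriv_ofReal_comp_mul {u : 𝓢(ℝ, ℝ)} {v : 𝓢(ℝ, ℂ)} {b c : ℝ}
    (hv : ∀ x, v x = ((b * u (c * x) : ℝ) : ℂ)) (x : ℝ) :
    derivCLM ℂ ℂ (derivCLM ℂ ℂ v) x = ((b * c ^ 2 * iteratedDeriv 2 u (c * x) : ℝ) : ℂ) := by
  have key : ∀ {u : 𝓢(ℝ, ℝ)} {v : 𝓢(ℝ, ℂ)} {b : ℝ}, (∀ x, v x = ((b * u (c * x) : ℝ) : ℂ)) →
      ∀ x, derivCLM ℂ ℂ v x = ((b * c * derivCLM ℝ ℝ u (c * x) : ℝ) : ℂ) := by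
    intro u v b hv x
    have h1 : HasDerivAt (fun x => c * x) c x := by simpa using (hasDerivAt_id x).const_mul c
    have h2 := (((u.hasDerivAt (c * x)).comp x h1).const_mul b).ofReal_comp
    have h3 : (v : ℝ → ℂ) = fun x => ((b * (u ∘ fun x => c * x) x : ℝ) : ℂ) := funext hv
    rw [derivCLM_apply, h3, h2.deriv, derivCLM_apply]
    congr 1
    ring
  have h3 : derivCLM ℝ ℝ (derivCLM ℝ ℝ u) (c * x) = iteratedDeriv 2 u (c * x) := by
    rw [iteratedDeriv_succ, iteratedDeriv_one]; rfl
  rw [key (key hv) x, h3]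
  congr 1
  ring

lemma jb_cube {l : ℝ} (hl : 0 < l) (x : ℝ) (r : ℝ) :
    jb (l ^ 3) x ^ r = l ^ r * (1 + (x / l) ^ 2) ^ (r / 2) := by
  have h1 : (l ^ 3) ^ ((2 : ℝ) / 3) = l ^ 2 := by
    rw [← Real.rpow_natCast, ← Real.rpow_mul hl.le, ← Real.rpow_natCast]; norm_num
  have h2 : x ^ 2 + l ^ 2 = l ^ 2 * (1 + (x / l) ^ 2) := by field_simp; ring
  unfold jb
  rw [h1, h2, ← Real.rpow_mul (by positivity), Real.mul_rpow (by positivity) (by positivity),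
    ← Real.rpow_natCast l, ← Real.rpow_mul hl.le]
  congr 2 <;> push_cast <;> ring

lemma integral_le_sq_of_HsNorm_le {f : ℝ → ℝ} {d : ℝ} (h : HsNorm (1 / 2) f ≤ d) :
    ∫ ξ : ℝ, |ξ| * ‖FT f ξ‖ ^ 2 ≤ d ^ 2 := by
  have h1 : HsNorm (1 / 2) f = √(∫ ξ : ℝ, |ξ| * ‖FT f ξ‖ ^ 2) := by
    unfold HsNorm
    rw [Real.sqrt_eq_rpow]
    norm_num
  rw [h1] at h
  exact (Real.sqrt_le_left ((Real.sqrt_nonneg _).trans h)).1 h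

/-- The rescaling `v(y) = (λ/δ)u(λy)`, `F(y) = δ⁻¹(L^{NL}u)(λy)`, with `t = λ³`. -/
lemma exists_rescaling {l d : ℝ} (hl : 0 < l) (hd : 0 < d) (hdl : d * l ≤ 1) {u : 𝓢(ℝ, ℝ)}
    (hu : ∀ x, |u x| ≤ d * (l ^ 3) ^ (-(1 : ℝ) / 4) * jb (l ^ 3) x ^ (-(1 : ℝ) / 4))
    (hL : HsNorm (1 / 2) (LNL (l ^ 3) u) ≤ d) :
    ∃ v F : 𝓢(ℝ, ℂ), (∀ ξ, FT u ξ = d * 𝓕 (v : ℝ → ℂ) (l * ξ)) ∧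
      (∀ z, ‖v z‖ ≤ (1 + z ^ 2) ^ (-(1 / 8) : ℝ)) ∧
      (∀ z : ℝ, ‖F z - z * v z + 3 * derivCLM ℂ ℂ (derivCLM ℂ ℂ v) z‖ ≤ 9) ∧
      ∫ ξ, |ξ| * ‖𝓕 (F : ℝ → ℂ) ξ‖ ^ 2 ≤ 1 := by
  obtain ⟨L, hLu⟩ := SchwartzMap.exists_eq_LNL (l ^ 3) u
  obtain ⟨v, hv⟩ := SchwartzMap.exists_ofReal_comp_mul u (l / d) hl.ne'
  obtain ⟨F, hF⟩ := SchwartzMap.exists_ofReal_comp_mul L d⁻¹ hl.ne'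
  have hFT : ∀ (f : ℝ → ℝ) (b ξ : ℝ),
      𝓕 (fun x => ((b * f (l * x) : ℝ) : ℂ)) (l * ξ) = ((b / l : ℝ) : ℂ) * FT f ξ := by
    intro f b ξ
    rw [fourier_comp_mul_left (fun x => ((b * f x : ℝ) : ℂ)) hl, mul_div_cancel_left₀ _ hl.ne']
    have : 𝓕 (fun x => ((b * f x : ℝ) : ℂ)) ξ = b * FT f ξ := by
      simp only [FT, fourier_eq_integral, Complex.ofReal_mul, mul_left_comm _ (b : ℂ),
        integral_const_mul]
    rw [this]
    push_cast
    ring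
  have hvb : ∀ z, ‖v z‖ ≤ (1 + z ^ 2) ^ (-(1 / 8) : ℝ) := fun z => by
    have h1 := hu (l * z)
    rw [jb_cube hl, mul_div_cancel_left₀ _ hl.ne', ← Real.rpow_natCast, ← Real.rpow_mul hl.le] at h1
    have h2 : l * l ^ (((3 : ℕ) : ℝ) * (-1 / 4)) * l ^ (-(1 : ℝ) / 4) = 1 := by
      nth_rewrite 1 [← Real.rpow_one l]
      rw [← Real.rpow_add hl, ← Real.rpow_add hl]
      norm_num
    have h3 : (-(1 : ℝ) / 4 / 2) = -(1 / 8) := by norm_num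
    rw [h3] at h1
    rw [hv, Complex.norm_real, Real.norm_eq_abs, abs_mul, abs_of_pos (by positivity),
      div_mul_eq_mul_div, div_le_iff₀ hd]
    calc _ ≤ _ := mul_le_mul_of_nonneg_left h1 hl.le
      _ = (l * l ^ (((3 : ℕ) : ℝ) * (-1 / 4)) * l ^ (-(1 : ℝ) / 4)) *
          ((1 + z ^ 2) ^ (-(1 / 8) : ℝ) * d) := by ring
      _ = _ := by rw [h2, one_mul]
  refine ⟨v, F, fun ξ => ?_, hvb, fun z => ?_, ?_⟩
  · rw [show (v : ℝ → ℂ) = fun x => ((l / d * u (l * x) : ℝ) : ℂ) from funext hv, hFT]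
    have : (d : ℂ) ≠ 0 := by exact_mod_cast hd.ne'
    have : (l : ℂ) ≠ 0 := by exact_mod_cast hl.ne'
    push_cast
    field_simp
  · have h1 : F z - z * v z + 3 * derivCLM ℂ ℂ (derivCLM ℂ ℂ v) z = (9 * (d * l) : ℝ) * v z ^ 2 := by
      rw [deriv_deriv_ofReal_comp_mul hv, hF, hv, hLu, LNL]
      norm_cast
      field_simp
      ring
    have h2 := norm_le_one_of_decay hvb z
    rw [h1, norm_mul, norm_pow, Complex.norm_real, Real.norm_of_nonneg (by positivity)]
    have h3 : ‖v z‖ ^ 2 ≤ 1 := pow_le_one₀ (norm_nonneg _) h2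
    have := mul_le_mul hdl h3 (by positivity) zero_le_one
    linarith
  · have h1 := integral_le_sq_of_HsNorm_le hL
    have h2 := Measure.integral_comp_mul_left (fun ξ : ℝ => |ξ| * ‖𝓕 (F : ℝ → ℂ) ξ‖ ^ 2) l
    rw [abs_of_pos (inv_pos.2 hl), smul_eq_mul, eq_inv_mul_iff_mul_eq₀ hl.ne'] at h2
    rw [← h2, ← integral_const_mul]
    have h3 : ∀ ξ : ℝ, l * (|l * ξ| * ‖𝓕 (F : ℝ → ℂ) (l * ξ)‖ ^ 2)
        = (d ^ 2)⁻¹ * (|ξ| * ‖FT (LNL (l ^ 3) u) ξ‖ ^ 2) := fun ξ => by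
      rw [show (F : ℝ → ℂ) = fun x => ((d⁻¹ * L (l * x) : ℝ) : ℂ) from funext hF, hFT,
        show (L : ℝ → ℝ) = LNL (l ^ 3) u from funext hLu, norm_mul, Complex.norm_real,
        Real.norm_of_nonneg (by positivity), abs_mul, abs_of_pos hl]
      field_simp
    simp only [h3]
    rw [integral_const_mul, inv_mul_le_iff₀ (by positivity), mul_one]
    exact h1

lemma fourier_uPM {χ : ℝ → ℝ} (hχ : IsCutoff χ) {l d s : ℝ} (hl : 0 < l) (hs : s = 1 ∨ s = -1)
    {u : ℝ → ℝ} {v : 𝓢(ℝ, ℂ)} (hv : ∀ ξ, FT u ξ = d * 𝓕 (v : ℝ → ℂ) (l * ξ)) (ξ : ℝ) :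
    𝓕 (uPM χ (l ^ 3) u s) ξ
      = d * ((posHigh χ (s * (l * ξ)) : ℂ) * 𝓕 (v : ℝ → ℂ) (l * ξ)) := by
  have hs2 : s * s = 1 := by rcases hs with rfl | rfl <;> norm_num
  have hs0 : s ≠ 0 := by rcases hs with rfl | rfl <;> norm_num
  obtain ⟨f, hf⟩ := (𝓕 v).exists_comp_mul hs0
  obtain ⟨k, hk⟩ := ((d : ℂ) • smulLeftCLM ℂ (posHigh χ) f).exists_comp_mul
    (mul_ne_zero hs0 hl.ne')
  have hk' : ∀ ξ, k ξ = d * ((posHigh χ (s * (l * ξ)) : ℂ) * 𝓕 (v : ℝ → ℂ) (l * ξ)) := fun ξ => by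
    rw [hk, smul_apply, smulLeftCLM_apply_apply (SmoothBdd.posHigh hχ).hasTemperateGrowth, hf,
      mul_assoc s l ξ, ← mul_assoc s s, hs2, one_mul, SchwartzMap.fourier_coe, smul_eq_mul,
      Complex.real_smul]
  have hl3 : (l ^ 3) ^ ((1 : ℝ) / 3) = l := by
    rw [← Real.rpow_natCast, ← Real.rpow_mul hl.le]; norm_num
  have hu : uPM χ (l ^ 3) u s = 𝓕⁻ (k : ℝ → ℂ) := by
    unfold uPM
    congr 1
    ext ξ
    have hχs : χ (s * (l * ξ)) = χ (l * ξ) := by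
      rcases hs with rfl | rfl
      · rw [one_mul]
      · rw [neg_one_mul, hχ.2.1]
    have hpos : 0 < s * (l * ξ) ↔ 0 < s * ξ := by
      rw [mul_left_comm]; exact mul_pos_iff_of_pos_left hl
    rw [hk', hv, hl3]
    simp only [posHigh, hpos, hχs]
    split_ifs
    · push_cast; ring
    · simp
  rw [hu, ← SchwartzMap.fourierInv_coe, ← SchwartzMap.fourier_coe,
    FourierTransform.fourier_fourierInv_eq, hk']

lemma norm_fourierInv_mul_fourier_uPM_le {χ : ℝ → ℝ} (hχ : IsCutoff χ) {l d s a B x : ℝ}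
    (hl : 0 < l) (hd : 0 < d) (hs : s = 1 ∨ s = -1)
    {u : ℝ → ℝ} {v : 𝓢(ℝ, ℂ)} (hv : ∀ ξ, FT u ξ = d * 𝓕 (v : ℝ → ℂ) (l * ξ))
    (hB : ‖𝓕⁻ (fun ξ : ℝ => ((posHigh χ (s * ξ) * (s * ξ) ^ (-a) : ℝ) : ℂ) *
      𝓕 (v : ℝ → ℂ) ξ) (x / l)‖ ≤ B) {m : ℝ → ℂ} {c : ℂ}
    (hm : ∀ ξ, 0 < s * ξ → m ξ = c * (((s * (l * ξ)) ^ (-a) : ℝ) : ℂ)) :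
    ‖𝓕⁻ (fun ξ => m ξ * 𝓕 (uPM χ (l ^ 3) u s) ξ) x‖ ≤ ‖c‖ * d * l⁻¹ * B := by
  set G : ℝ → ℂ := fun ξ : ℝ => ((posHigh χ (s * ξ) * (s * ξ) ^ (-a) : ℝ) : ℂ) *
      𝓕 (v : ℝ → ℂ) ξ with hG
  have h : (fun ξ => m ξ * 𝓕 (uPM χ (l ^ 3) u s) ξ) = fun ξ => (c * d) * G (l * ξ) := by
    ext ξ
    rw [fourier_uPM hχ hl hs hv, hG]
    by_cases h0 : 0 < s * ξ
    · rw [hm ξ h0]; push_cast; ring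
    · have : s * (l * ξ) ≤ 1 := by
        rw [mul_left_comm]
        exact (mul_nonpos_of_nonneg_of_nonpos hl.le (not_lt.1 h0)).trans zero_le_one
      simp [posHigh_of_le_one hχ this]
  rw [h, fourierInv_const_mul (c * d) (fun ξ => G (l * ξ)), fourierInv_comp_mul_left G hl,
    norm_mul, norm_mul, norm_mul, norm_inv, Complex.norm_real, Complex.norm_real,
    Real.norm_of_nonneg hd.le, Real.norm_of_nonneg hl.le, ← mul_assoc]
  gcongr

/-- Pointwise bounds for the low frequencies of `u^±`. -/
theorem u_pm_low_frequency_pointwise_bounds :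
    ∀ χ : ℝ → ℝ, IsCutoff χ →
    ∃ C : ℝ, 0 < C ∧
      ∀ t ε M : ℝ, 0 < t → 0 < ε → 1 ≤ M → M * ε * t ^ ((1:ℝ)/3) ≤ 1 →
      ∀ u : 𝓢(ℝ, ℝ), Bootstrap M ε t ⇑u →
        BesovEpsNorm ε ⇑u ≤ ε → HsNorm ((1:ℝ)/2) (LNL t ⇑u) ≤ M * ε →
        ∀ s : ℝ, s = 1 ∨ s = -1 → ∀ x : ℝ,
          ‖invDerivOf (uPM χ t ⇑u s) x‖
              ≤ C * M * ε * t ^ ((1:ℝ)/4) * jb t x ^ (-(3:ℝ)/4) ∧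
          ‖absDinv32 (uPM χ t ⇑u s) x‖
              ≤ C * M * ε * t ^ ((1:ℝ)/2) * (jb t x)⁻¹ := by
  intro χ hχ
  obtain ⟨C₁, hC₁, h₁⟩ := exists_norm_fourierInv_posHigh_le hχ (a := 1) le_rfl (by norm_num)
  obtain ⟨C₂, hC₂, h₂⟩ := exists_norm_fourierInv_posHigh_le hχ (a := 3 / 2) (by norm_num) le_rfl
  refine ⟨C₁ + C₂ + 1, by positivity, fun t ε M ht hε hM hsmall u hu _ hL s hs x => ?_⟩
  obtain ⟨l, hl, rfl⟩ : ∃ l : ℝ, 0 < l ∧ t = l ^ 3 := ⟨t ^ ((1 : ℝ) / 3), by positivity, by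
    rw [← Real.rpow_natCast, ← Real.rpow_mul ht.le]; norm_num⟩
  have hl3 : ∀ r : ℝ, (l ^ 3) ^ r = l ^ (3 * r) := fun r => by
    rw [← Real.rpow_natCast, ← Real.rpow_mul hl.le]; norm_num
  have hd : 0 < M * ε := by positivity
  have hdl : M * ε * l ≤ 1 := by
    rw [hl3] at hsmall
    norm_num at hsmall
    exact hsmall
  obtain ⟨v, F, hv, hvb, hvF, hF⟩ := exists_rescaling hl hd hdl (fun x => (hu x).1) hL
  have hFi : Integrable fun ξ : ℝ => |ξ| * ‖𝓕 (F : ℝ → ℂ) ξ‖ ^ 2 := by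
    simpa only [SchwartzMap.fourier_coe] using (𝓕 F).integrable_abs_mul_norm_sq
  have hσ : |s| = 1 := by rcases hs with rfl | rfl <;> simp
  have hs2 : s * s = 1 := by rcases hs with rfl | rfl <;> norm_num
  have hsC : (s : ℂ) * s = 1 := by exact_mod_cast hs2
  have hs0 : (s : ℂ) ≠ 0 := left_ne_zero_of_mul_eq_one hsC
  have hlC : (l : ℂ) ≠ 0 := by exact_mod_cast hl.ne'
  have k₁ := norm_fourierInv_mul_fourier_uPM_le hχ (x := x) hl hd hs hv
    (h₁ v F hvb hvF hF hFi s (x / l) hσ) (m := fun ξ => (Complex.I * (ξ : ℂ))⁻¹)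
    (c := -Complex.I * s * l) fun ξ hξ => by
      have hξ0 : (ξ : ℂ) ≠ 0 := by
        exact_mod_cast (right_ne_zero_of_mul hξ.ne')
      rw [Real.rpow_neg_one]
      push_cast
      field_simp
      simp
  have k₂ := norm_fourierInv_mul_fourier_uPM_le hχ (x := x) hl hd hs hv
    (h₂ v F hvb hvF hF hFi s (x / l) hσ) (m := fun ξ => ((|ξ| ^ (-(3 : ℝ) / 2) : ℝ) : ℂ))
    (c := ((l ^ ((3 : ℝ) / 2) : ℝ) : ℂ)) fun ξ hξ => by
      have hξ0 : |ξ| = s * ξ := by rw [← abs_of_pos hξ, abs_mul, hσ, one_mul]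
      rw [← Complex.ofReal_mul, hξ0, mul_left_comm s l ξ, Real.mul_rpow hl.le hξ.le, ← mul_assoc,
        ← Real.rpow_add hl]
      norm_num
  constructor
  · refine k₁.trans ?_
    rw [hl3, jb_cube hl, norm_mul, norm_mul, norm_neg, Complex.norm_I, Complex.norm_real,
      Complex.norm_real, Real.norm_eq_abs s, hσ, Real.norm_of_nonneg hl.le]
    have e : l ^ (3 * ((1 : ℝ) / 4)) * l ^ (-(3 : ℝ) / 4) = 1 := by
      rw [← Real.rpow_add hl]; norm_num
    have e' : -((1 : ℝ) / 4 + 1 / 8) = -(3 : ℝ) / 4 / 2 := by norm_num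
    rw [e']
    set P := (1 + (x / l) ^ 2) ^ (-(3 : ℝ) / 4 / 2)
    have hP : 0 ≤ P := by positivity
    calc 1 * 1 * l * (M * ε) * l⁻¹ * (C₁ * P) = C₁ * (M * ε * P) := by field_simp
      _ ≤ (C₁ + C₂ + 1) * (M * ε * P) := by gcongr; linarith
      _ = (C₁ + C₂ + 1) * M * ε * (l ^ (3 * ((1 : ℝ) / 4)) * l ^ (-(3 : ℝ) / 4)) * P := by
        rw [e]; ring
      _ = _ := by ring
  · refine k₂.trans ?_
    rw [hl3, ← Real.rpow_neg_one (jb _ _), jb_cube hl, Complex.norm_real,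
      Real.norm_of_nonneg (by positivity)]
    have e' : -((3 : ℝ) / 2 / 4 + 1 / 8) = -(1 : ℝ) / 2 := by norm_num
    rw [e', show 3 * ((1 : ℝ) / 2) = 3 / 2 by norm_num, Real.rpow_neg_one l]
    set P := (1 + (x / l) ^ 2) ^ (-(1 : ℝ) / 2)
    have hP : 0 ≤ P := by positivity
    set Q := l ^ ((3 : ℝ) / 2)
    have hQ : 0 ≤ Q := by positivity
    calc Q * (M * ε) * l⁻¹ * (C₂ * P) = C₂ * (M * ε * Q * (l⁻¹ * P)) := by ring
      _ ≤ (C₁ + C₂ + 1) * (M * ε * Q * (l⁻¹ * P)) := by gcongr; linarith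
      _ = _ := by ring
end
end

section
/- Let N be a positive integer and let u : ℝ → ℝ be locally integrable with ∫_ℝ |x|·u₋(x) dx ≤ N, where u₋(x) := max(-u(x), 0). Then the Schrödinger operator -d²/dx² + u has at most N negative eigenvalues in the variational sense: for every (N+1)-dimensional subspace V of the real vector space of smooth compactly supported functions ℝ → ℝ, there exists φ ∈ V with φ ≠ 0 and ∫_ℝ (φ'(x)² + u(x)·φ(x)²) dx ≥ 0. -/
open MeasureTheory
open scoped ENNReal

noncomputable section

/-- A smooth compactly supported function has a square integrable
derivative. -/
theorem memLp_deriv_of_hasCompactSupport {φ : ℝ → ℝ} (h : ContDiff ℝ (⊤ : ℕ∞) φ)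
    (hc : HasCompactSupport φ) : MemLp (deriv φ) 2 (volume : Measure ℝ) :=
  (h.continuous_deriv (by simp)).memLp_of_hasCompactSupport hc.deriv

/-- The derivative, as a linear map from a space of test functions to `L²(ℝ)`. -/
def derivL2 (V : Submodule ℝ (ℝ → ℝ))
    (hV : ∀ φ ∈ V, ContDiff ℝ (⊤ : ℕ∞) φ ∧ HasCompactSupport φ) :
    V →ₗ[ℝ] Lp ℝ 2 (volume : Measure ℝ) where
  toFun φ := (memLp_deriv_of_hasCompactSupport (hV φ φ.2).1 (hV φ φ.2).2).toLp
  map_add' φ ψ := by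
    rw [← MemLp.toLp_add]
    congr 1
    ext x
    exact deriv_add (((hV φ φ.2).1.differentiable (by simp)) x)
      (((hV ψ ψ.2).1.differentiable (by simp)) x)
  map_smul' c φ := by
    rw [RingHom.id_apply, ← MemLp.toLp_const_smul]
    congr 1
    ext x
    exact deriv_const_smul c (((hV φ φ.2).1.differentiable (by simp)) x)

section derivL2

variable {V : Submodule ℝ (ℝ → ℝ)}
  (hV : ∀ φ ∈ V, ContDiff ℝ (⊤ : ℕ∞) φ ∧ HasCompactSupport φ)

theorem coeFn_derivL2 (φ : V) : derivL2 V hV φ =ᵐ[volume] deriv φ.1 :=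
  (memLp_deriv_of_hasCompactSupport (hV φ φ.2).1 (hV φ φ.2).2).coeFn_toLp

theorem norm_derivL2_sq (φ : V) : ‖derivL2 V hV φ‖ ^ 2 = ∫ x, deriv φ.1 x ^ 2 := by
  rw [← real_inner_self_eq_norm_sq, L2.inner_def]
  refine integral_congr_ae ?_
  filter_upwards [coeFn_derivL2 hV φ] with x hx
  simp [hx]

theorem eq_zero_of_derivL2_eq_zero {φ : V} (h0 : φ.1 0 = 0) (h : derivL2 V hV φ = 0) :
    φ = 0 := by
  have hd : deriv φ.1 =ᵐ[volume] (fun _ => (0 : ℝ)) := by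
    have h1 := coeFn_derivL2 hV φ
    rw [h] at h1
    exact h1.symm.trans (Lp.coeFn_zero ℝ 2 volume)
  have hd' := (((hV φ φ.2).1.continuous_deriv (by simp)).ae_eq_iff_eq volume
    continuous_const).1 hd
  ext x
  have := is_const_of_deriv_eq_zero ((hV φ φ.2).1.differentiable (by simp))
    (fun y => congrFun hd' y) x 0
  simpa [h0] using this

/-- Bessel's inequality against the indicator function of the interval between `0` and `x`. -/
theorem sum_sq_le_abs_of_orthonormal_derivL2 {ι : Type*} [Fintype ι] {e : ι → V}
    (h0 : ∀ i, (e i).1 0 = 0) (he : Orthonormal ℝ fun i => derivL2 V hV (e i)) (x : ℝ) :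
    ∑ i, (e i).1 x ^ 2 ≤ |x| := by
  have hfin : (volume : Measure ℝ) (Set.uIoc 0 x) ≠ ∞ := by simp
  have hms : MeasurableSet (Set.uIoc (0 : ℝ) x) := measurableSet_uIoc
  set f := indicatorConstLp 2 hms hfin (1 : ℝ)
  have hnorm : ‖f‖ ^ 2 = |x| := by
    rw [← real_inner_self_eq_norm_sq, L2.inner_indicatorConstLp_one,
      setIntegral_congr_ae (g := fun _ => (1 : ℝ)) hms]
    · simp [Measure.real, Real.volume_uIoc]
    · filter_upwards [indicatorConstLp_coeFn_mem (p := 2) (hs := hms) (hμs := hfin)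
        (c := (1 : ℝ))] with y hy using hy
  rw [← hnorm]
  refine le_trans (Finset.sum_le_sum fun i _ => ?_)
    (he.sum_inner_products_le f (s := Finset.univ))
  rw [real_inner_comm, L2.inner_indicatorConstLp_one,
    setIntegral_congr_ae (g := deriv (e i).1) hms
      ((coeFn_derivL2 hV (e i)).mono fun y hy _ => hy),
    ← intervalIntegral.norm_intervalIntegral_eq,
    intervalIntegral.integral_deriv_eq_sub
      (fun y _ => (hV _ (e i).2).1.differentiable (by simp) y)
      (((hV _ (e i).2).1.continuous_deriv (by simp)).intervalIntegrable _ _), h0 i]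
  simp

/-- Among the test functions in `V` that vanish at `0`, at least `finrank V - 1` have
orthonormal derivatives. -/
theorem exists_orthonormal_derivL2 [FiniteDimensional ℝ V] :
    ∃ (m : ℕ) (e : Fin m → V), Module.finrank ℝ V ≤ m + 1 ∧ (∀ i, (e i).1 0 = 0) ∧
      Orthonormal ℝ fun i => derivL2 V hV (e i) := by
  let ev : V →ₗ[ℝ] ℝ := (LinearMap.proj 0).comp V.subtype
  let T := (derivL2 V hV).comp (LinearMap.ker ev).subtype
  have hT : Function.Injective T := by
    intro φ ψ h
    refine Subtype.ext (sub_eq_zero.1 (eq_zero_of_derivL2_eq_zero hV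
      (LinearMap.mem_ker.1 (sub_mem φ.2 ψ.2)) ?_))
    rw [map_sub]
    exact sub_eq_zero.2 h
  let b := stdOrthonormalBasis ℝ (LinearMap.range T)
  choose e he using fun i => (b i).2
  refine ⟨_, fun i => (e i).1, ?_, fun i => (e i).2, ?_⟩
  · have h1 := ev.finrank_range_add_finrank_ker
    have h2 := (LinearMap.range ev).finrank_le
    rw [LinearMap.finrank_range_of_inj hT]
    simp only [Module.finrank_self] at h2
    lia
  · have : (fun i => derivL2 V hV (e i).1) = fun i => ((b i : LinearMap.range T) : Lp ℝ 2 _) :=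
      funext he
    rw [this]
    exact b.orthonormal.comp_linearIsometry (LinearMap.range T).subtypeₗᵢ

end derivL2

theorem integral_deriv_sq_lt_of_form_neg {u φ : ℝ → ℝ}
    (hloc : LocallyIntegrable u (volume : Measure ℝ))
    (h : ContDiff ℝ (⊤ : ℕ∞) φ) (hc : HasCompactSupport φ)
    (hneg : (∫ x : ℝ, (deriv φ x ^ 2 + u x * φ x ^ 2)) < 0) :
    Integrable (fun x => max (-u x) 0 * φ x ^ 2) ∧
      ∫ x, deriv φ x ^ 2 < ∫ x, max (-u x) 0 * φ x ^ 2 := by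
  have hc2 : HasCompactSupport fun x => φ x ^ 2 := hc.comp_left (g := fun y => y ^ 2) (by simp)
  have hu : Integrable fun x => u x * φ x ^ 2 := by
    simpa [mul_comm] using
      hloc.integrable_smul_left_of_hasCompactSupport (h.continuous.pow 2) hc2
  have hm : Integrable fun x => max (-u x) 0 * φ x ^ 2 := by
    refine hu.neg.pos_part.congr (.of_forall fun x => ?_)
    simp [max_mul_of_nonneg _ _ (sq_nonneg (φ x))]
  refine ⟨hm, ?_⟩
  rw [integral_add (memLp_deriv_of_hasCompactSupport h hc).integrable_sq hu] at hneg
  have : ∫ x, -(u x * φ x ^ 2) ≤ ∫ x, max (-u x) 0 * φ x ^ 2 :=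
    integral_mono hu.neg hm fun x => by
      simpa using mul_le_mul_of_nonneg_right (le_max_left (-u x) 0) (sq_nonneg (φ x))
  rw [integral_neg] at this
  linarith

/-- If `∫ |x|·u₋(x) dx ≤ N` then the Schrödinger operator `-d²/dx² + u` has at
most `N` negative eigenvalues, in the variational sense. -/
theorem at_most_N_negative_eigenvalues
    (N : ℕ) (hN : 0 < N) (u : ℝ → ℝ)
    (hloc : LocallyIntegrable u (volume : Measure ℝ))
    (hint : (∫⁻ x : ℝ, ENNReal.ofReal (|x| * max (-u x) 0)) ≤ (N : ℝ≥0∞))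
    (V : Submodule ℝ (ℝ → ℝ))
    (hV : ∀ φ ∈ V, ContDiff ℝ (⊤ : ℕ∞) φ ∧ HasCompactSupport φ)
    (hdim : Module.finrank ℝ V = N + 1) :
    ∃ φ ∈ V, φ ≠ 0 ∧ 0 ≤ ∫ x : ℝ, (deriv φ x ^ 2 + u x * φ x ^ 2) := by
  by_contra! hneg
  have : FiniteDimensional ℝ V := Module.finite_of_finrank_eq_succ hdim
  obtain ⟨m, e, hm, h0, he⟩ := exists_orthonormal_derivL2 hV
  have hNm : N ≤ m := by lia
  have hnn : ∀ x, 0 ≤ |x| * max (-u x) 0 := fun x => by positivity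
  have hmeas : AEStronglyMeasurable (fun x => |x| * max (-u x) 0) (volume : Measure ℝ) :=
    continuous_abs.aestronglyMeasurable.mul
      (hloc.aestronglyMeasurable.neg.sup aestronglyMeasurable_const)
  have hI : Integrable fun x => |x| * max (-u x) 0 :=
    ⟨hmeas, (hasFiniteIntegral_iff_ofReal (.of_forall hnn)).2
      (hint.trans_lt (ENNReal.natCast_lt_top N))⟩
  have hIle : ∫ x, |x| * max (-u x) 0 ≤ N := by
    rw [integral_eq_lintegral_of_nonneg_ae (.of_forall hnn) hmeas]
    exact ENNReal.toReal_le_of_le_ofReal (by positivity) (by simpa using hint)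
  have key : ∀ i, Integrable (fun x => max (-u x) 0 * (e i).1 x ^ 2) ∧
      1 < ∫ x, max (-u x) 0 * (e i).1 x ^ 2 := by
    intro i
    have hne : (e i).1 ≠ 0 := fun h => he.ne_zero i (by
      rw [show e i = 0 from Subtype.ext h, map_zero])
    have := integral_deriv_sq_lt_of_form_neg hloc (hV _ (e i).2).1 (hV _ (e i).2).2
      (hneg _ (e i).2 hne)
    rwa [← norm_derivL2_sq hV (e i), he.1 i, one_pow] at this
  have hsum : (m : ℝ) < ∑ i, ∫ x, max (-u x) 0 * (e i).1 x ^ 2 := by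
    have : NeZero m := ⟨by lia⟩
    simpa using Finset.sum_lt_sum_of_nonempty Finset.univ_nonempty fun i _ => (key i).2
  rw [← integral_finsetSum _ fun i _ => (key i).1] at hsum
  have hle : ∫ x, ∑ i, max (-u x) 0 * (e i).1 x ^ 2 ≤ ∫ x, |x| * max (-u x) 0 :=
    integral_mono (integrable_finsetSum _ fun i _ => (key i).1) hI fun x => by
      simp only [← Finset.mul_sum]
      rw [mul_comm |x|]
      exact mul_le_mul_of_nonneg_left (sum_sq_le_abs_of_orthonormal_derivL2 hV h0 he x)
        (le_max_right _ _)
  have : (N : ℝ) ≤ m := by exact_mod_cast hNm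
  linarith
end
end

section
/- For every integer N ≥ 1 and every ε > 0 there exists a measurable function u : ℝ → ℝ with u(x) ≤ 0 for all x and ∫_ℝ |x|·|u(x)| dx ≤ N - 1 + ε, such that the Schrödinger operator -d²/dx² + u has at least N negative eigenvalues in the variational sense: there exists an N-dimensional subspace V of the real vector space of smooth compactly supported functions ℝ → ℝ such that ∫_ℝ (φ'(x)² + u(x)·φ(x)²) dx < 0 for every φ ∈ V with φ ≠ 0. -/
open MeasureTheory

noncomputable section

/-- The data of a potential `u` of weighted mass `∫ |x||u| ≤ κ` and an `n`-dimensional space `V` of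
smooth functions on which its quadratic form is negative definite, all supported in `[-ρ, ρ]`. -/
structure IsTrialSpace (n : ℕ) (κ ρ : ℝ) (u : ℝ → ℝ) (V : Submodule ℝ (ℝ → ℝ)) : Prop where
  measurable : Measurable u
  nonpos : ∀ x, u x ≤ 0
  mass_le : ∫⁻ x : ℝ, ENNReal.ofReal (|x| * |u x|) ≤ ENNReal.ofReal κ
  potential_eq_zero : ∀ x, ρ < |x| → u x = 0
  contDiff : ∀ φ ∈ V, ContDiff ℝ (⊤ : ℕ∞) φ
  eq_zero : ∀ φ ∈ V, ∀ x, ρ < |x| → φ x = 0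
  integrable : ∀ φ ∈ V, Integrable fun x ↦ deriv φ x ^ 2 + u x * φ x ^ 2
  finiteDimensional : FiniteDimensional ℝ V
  finrank_eq : Module.finrank ℝ V = n
  form_neg : ∀ φ ∈ V, φ ≠ 0 → ∫ x : ℝ, (deriv φ x ^ 2 + u x * φ x ^ 2) < 0

/-- A potential well `w` of weighted mass `∫ |x||w| ≤ κ` together with a smooth function `ψ` on which
its quadratic form is negative, both supported in `σ ≤ |x| ≤ τ`. -/
structure IsWell (κ σ τ : ℝ) (w ψ : ℝ → ℝ) : Prop where
  measurable : Measurable w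
  nonpos : ∀ x, w x ≤ 0
  mass_le : ∫⁻ x : ℝ, ENNReal.ofReal (|x| * |w x|) ≤ ENNReal.ofReal κ
  potential_eq_zero_of_lt : ∀ x, |x| < σ → w x = 0
  potential_eq_zero_of_gt : ∀ x, τ < |x| → w x = 0
  contDiff : ContDiff ℝ (⊤ : ℕ∞) ψ
  eq_zero_of_lt : ∀ x, |x| < σ → ψ x = 0
  eq_zero_of_gt : ∀ x, τ < |x| → ψ x = 0
  integrable : Integrable fun x ↦ deriv ψ x ^ 2 + w x * ψ x ^ 2
  form_neg : ∫ x : ℝ, (deriv ψ x ^ 2 + w x * ψ x ^ 2) < 0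

theorem deriv_eq_zero_of_forall_abs_lt {f : ℝ → ℝ} {σ : ℝ} (hf : ∀ x, |x| < σ → f x = 0)
    {x : ℝ} (hx : |x| < σ) : deriv f x = 0 := by
  have : f =ᶠ[nhds x] fun _ ↦ 0 := by
    filter_upwards [(isOpen_lt continuous_abs continuous_const).mem_nhds hx] with y hy
    exact hf y hy
  simp [this.deriv_eq]

theorem deriv_eq_zero_of_forall_lt_abs {f : ℝ → ℝ} {ρ : ℝ} (hf : ∀ x, ρ < |x| → f x = 0)
    {x : ℝ} (hx : ρ < |x|) : deriv f x = 0 := by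
  have : f =ᶠ[nhds x] fun _ ↦ 0 := by
    filter_upwards [(isOpen_lt continuous_const continuous_abs).mem_nhds hx] with y hy
    exact hf y hy
  simp [this.deriv_eq]

theorem IsWell.ne_zero {κ σ τ : ℝ} {w ψ : ℝ → ℝ} (h : IsWell κ σ τ w ψ) : ψ ≠ 0 := by
  rintro rfl
  simpa using h.form_neg

theorem IsWell.mono {κ σ τ τ' : ℝ} {w ψ : ℝ → ℝ} (h : IsWell κ σ τ w ψ) (hτ : τ ≤ τ') :
    IsWell κ σ τ' w ψ :=
  { h with
    potential_eq_zero_of_gt := fun x hx ↦ h.potential_eq_zero_of_gt x (hτ.trans_lt hx)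
    eq_zero_of_gt := fun x hx ↦ h.eq_zero_of_gt x (hτ.trans_lt hx) }

/-- A well located outside the support of a trial space increases its dimension by one. -/
theorem IsTrialSpace.sup_span {n : ℕ} {κ ρ κ' σ τ : ℝ} {u w ψ : ℝ → ℝ}
    {V : Submodule ℝ (ℝ → ℝ)} (h : IsTrialSpace n κ ρ u V) (h' : IsWell κ' σ τ w ψ)
    (hκ : 0 ≤ κ) (hκ' : 0 ≤ κ') (hρσ : ρ < σ) (hρτ : ρ ≤ τ) :
    IsTrialSpace (n + 1) (κ + κ') τ (u + w) (V ⊔ Submodule.span ℝ {ψ}) := by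
  have mem {f : ℝ → ℝ} (hf : f ∈ V ⊔ Submodule.span ℝ {ψ}) :
      ∃ φ ∈ V, ∃ c : ℝ, f = φ + c • ψ := by
    obtain ⟨φ, hφ, g, hg, rfl⟩ := Submodule.mem_sup.1 hf
    obtain ⟨c, rfl⟩ := Submodule.mem_span_singleton.1 hg
    exact ⟨φ, hφ, c, rfl⟩
  have form {φ : ℝ → ℝ} (hφ : φ ∈ V) (c : ℝ) :
      (fun x ↦ deriv (φ + c • ψ) x ^ 2 + (u + w) x * (φ + c • ψ) x ^ 2) =
        fun x ↦ (deriv φ x ^ 2 + u x * φ x ^ 2) + c ^ 2 * (deriv ψ x ^ 2 + w x * ψ x ^ 2) := by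
    funext x
    have hφd : DifferentiableAt ℝ φ x := ((h.contDiff φ hφ).differentiable (by simp)) x
    have hψd : DifferentiableAt ℝ ψ x := (h'.contDiff.differentiable (by simp)) x
    rw [deriv_add hφd (hψd.const_smul c), deriv_const_smul c hψd]
    simp only [Pi.add_apply, Pi.smul_apply, smul_eq_mul]
    rcases lt_or_ge |x| σ with hx | hx
    · rw [deriv_eq_zero_of_forall_abs_lt h'.eq_zero_of_lt hx, h'.eq_zero_of_lt x hx,
        h'.potential_eq_zero_of_lt x hx]
      ring
    · have hx' := hρσ.trans_le hx
      rw [deriv_eq_zero_of_forall_lt_abs (h.eq_zero φ hφ) hx', h.eq_zero φ hφ x hx',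
        h.potential_eq_zero x hx']
      ring
  have hV := h.finiteDimensional
  refine ⟨h.measurable.add h'.measurable, fun x ↦ add_nonpos (h.nonpos x) (h'.nonpos x), ?_, ?_, ?_,
    ?_, ?_, inferInstance, ?_, ?_⟩
  · calc ∫⁻ x : ℝ, ENNReal.ofReal (|x| * |(u + w) x|)
        ≤ ∫⁻ x : ℝ, (ENNReal.ofReal (|x| * |u x|) + ENNReal.ofReal (|x| * |w x|)) := by
          refine lintegral_mono fun x ↦ ?_
          rw [← ENNReal.ofReal_add (by positivity) (by positivity), ← mul_add]
          exact ENNReal.ofReal_le_ofReal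
            (mul_le_mul_of_nonneg_left (abs_add_le _ _) (abs_nonneg _))
      _ = (∫⁻ x : ℝ, ENNReal.ofReal (|x| * |u x|)) + ∫⁻ x : ℝ, ENNReal.ofReal (|x| * |w x|) :=
          lintegral_add_left
            ((continuous_abs.measurable.mul h.measurable.abs).ennreal_ofReal) _
      _ ≤ ENNReal.ofReal (κ + κ') := by
          rw [ENNReal.ofReal_add hκ hκ']
          exact add_le_add h.mass_le h'.mass_le
  · intro x hx
    simp [h.potential_eq_zero x (hρτ.trans_lt hx), h'.potential_eq_zero_of_gt x hx]
  · intro f hf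
    obtain ⟨φ, hφ, c, rfl⟩ := mem hf
    exact (h.contDiff φ hφ).add (h'.contDiff.const_smul c)
  · intro f hf x hx
    obtain ⟨φ, hφ, c, rfl⟩ := mem hf
    simp [h.eq_zero φ hφ x (hρτ.trans_lt hx), h'.eq_zero_of_gt x hx]
  · intro f hf
    obtain ⟨φ, hφ, c, rfl⟩ := mem hf
    rw [form hφ]
    exact (h.integrable φ hφ).add (h'.integrable.const_mul _)
  · have hdisj : V ⊓ Submodule.span ℝ {ψ} = ⊥ := by
      rw [eq_bot_iff]
      rintro f ⟨hf, hf'⟩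
      obtain ⟨c, rfl⟩ := Submodule.mem_span_singleton.1 hf'
      rw [Submodule.mem_bot]
      funext x
      rcases lt_or_ge |x| σ with hx | hx
      · simp [h'.eq_zero_of_lt x hx]
      · exact h.eq_zero _ hf x (hρσ.trans_le hx)
    have := Submodule.finrank_sup_add_finrank_inf_eq V (Submodule.span ℝ {ψ})
    rw [hdisj, finrank_bot, finrank_span_singleton h'.ne_zero, h.finrank_eq] at this
    simpa using this
  · intro f hf hf0
    obtain ⟨φ, hφ, c, rfl⟩ := mem hf
    rw [form hφ, integral_add (h.integrable φ hφ) (h'.integrable.const_mul _), integral_const_mul]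
    by_cases hφ0 : φ = 0
    · have hc : c ≠ 0 := by
        rintro rfl
        simp [hφ0] at hf0
      have := mul_neg_of_pos_of_neg (by positivity : 0 < c ^ 2) h'.form_neg
      simpa [hφ0] using this
    · exact add_neg_of_neg_of_nonpos (h.form_neg φ hφ hφ0)
        (mul_nonpos_of_nonneg_of_nonpos (sq_nonneg c) h'.form_neg.le)

/-- A smooth plateau equal to `1` on `[p, q]` whose Dirichlet energy is at most that of the trapezoid
with sides of lengths `2r` and `2s`. -/
theorem exists_smooth_plateau {p q r s : ℝ} (hpq : p ≤ q) (hr : 0 < r) (hs : 0 < s) :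
    ∃ ψ : ℝ → ℝ, ContDiff ℝ (⊤ : ℕ∞) ψ ∧ (∀ x ∈ Set.Icc p q, ψ x = 1) ∧
      (∀ x ≤ p - 2 * (r + 1), ψ x = 0) ∧ (∀ x, q + 2 * (s + 1) ≤ x → ψ x = 0) ∧
      Integrable (fun x ↦ deriv ψ x ^ 2) ∧
      ∫ x : ℝ, deriv ψ x ^ 2 ≤ 1 / (2 * r) + 1 / (2 * s) := by
  let f : ContDiffBump (p - (r + 1)) := ⟨r, r + 1, hr, by linarith⟩
  let g : ContDiffBump (q + (s + 1)) := ⟨s, s + 1, hs, by linarith⟩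
  set F : ℝ → ℝ := f.normed volume with hF
  set G : ℝ → ℝ := g.normed volume with hG
  have hFc : Continuous F := f.continuous_normed
  have hGc : Continuous G := g.continuous_normed
  have hFsupp : Function.support F = Set.Ioo (p - 2 * (r + 1)) p := by
    rw [hF, f.support_normed_eq, Real.ball_eq_Ioo]
    change Set.Ioo (p - (r + 1) - (r + 1)) (p - (r + 1) + (r + 1)) = _
    congr 1 <;> ring
  have hGsupp : Function.support G = Set.Ioo q (q + 2 * (s + 1)) := by
    rw [hG, g.support_normed_eq, Real.ball_eq_Ioo]
    change Set.Ioo (q + (s + 1) - (s + 1)) (q + (s + 1) + (s + 1)) = _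
    congr 1 <;> ring
  have hFi : Integrable F := f.integrable_normed
  have hGi : Integrable G := g.integrable_normed
  have hFint : ∫ x, F x = 1 := f.integral_normed
  have hGint : ∫ x, G x = 1 := g.integral_normed
  set a := p - 2 * (r + 1) with ha
  set b := q + 2 * (s + 1) with hb
  have Fone : ∀ x, p ≤ x → ∫ t in a..x, F t = 1 := fun x hx ↦ by
    rw [intervalIntegral.integral_eq_integral_of_support_subset, hFint]
    rw [hFsupp]
    exact fun y hy ↦ ⟨hy.1, hy.2.le.trans hx⟩
  have Fzero : ∀ x ≤ a, ∫ t in a..x, F t = 0 := fun x hx ↦ by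
    refine intervalIntegral.integral_zero_ae (.of_forall fun t ht ↦ ?_)
    rw [Set.uIoc_of_ge hx] at ht
    refine Function.notMem_support.1 fun ht' ↦ ?_
    rw [hFsupp] at ht'
    exact ht'.1.not_ge ht.2
  have Gone : ∀ x, b ≤ x → ∫ t in a..x, G t = 1 := fun x hx ↦ by
    rw [intervalIntegral.integral_eq_integral_of_support_subset, hGint]
    rw [hGsupp]
    exact fun y hy ↦ ⟨by linarith [hy.1], hy.2.le.trans hx⟩
  have Gzero : ∀ x ≤ q, ∫ t in a..x, G t = 0 := fun x hx ↦ by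
    refine intervalIntegral.integral_zero_ae (.of_forall fun t ht ↦ ?_)
    refine Function.notMem_support.1 fun ht' ↦ ?_
    rw [hGsupp] at ht'
    have := ht.2.trans (max_le (by linarith : a ≤ q) hx)
    exact ht'.1.not_ge this
  have hsub : ∀ x, ∫ t in a..x, (F t - G t) = (∫ t in a..x, F t) - ∫ t in a..x, G t := fun x ↦
    intervalIntegral.integral_sub (hFc.intervalIntegrable _ _) (hGc.intervalIntegrable _ _)
  have hderiv : ∀ x, HasDerivAt (fun x ↦ ∫ t in a..x, (F t - G t)) (F x - G x) x := fun x ↦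
    (hFc.sub hGc).integral_hasStrictDerivAt a x |>.hasDerivAt
  have hderiv' : deriv (fun x ↦ ∫ t in a..x, (F t - G t)) = fun x ↦ F x - G x :=
    funext fun x ↦ (hderiv x).deriv
  have hFn : ∀ x, 0 ≤ F x := fun x ↦ f.nonneg_normed x
  have hGn : ∀ x, 0 ≤ G x := fun x ↦ g.nonneg_normed x
  have hFle : ∀ x, F x ≤ 1 / (2 * r) := fun x ↦ by
    refine (f.normed_le_div_measure_closedBall_rIn volume x).trans_eq ?_
    rw [Real.volume_real_closedBall f.rIn_pos.le]
  have hGle : ∀ x, G x ≤ 1 / (2 * s) := fun x ↦ by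
    refine (g.normed_le_div_measure_closedBall_rIn volume x).trans_eq ?_
    rw [Real.volume_real_closedBall g.rIn_pos.le]
  have hle : ∀ x, (F x - G x) ^ 2 ≤ 1 / (2 * r) * F x + 1 / (2 * s) * G x := fun x ↦ by
    nlinarith [mul_nonneg (hFn x) (hGn x), mul_le_mul_of_nonneg_right (hFle x) (hFn x),
      mul_le_mul_of_nonneg_right (hGle x) (hGn x)]
  have hdom : Integrable fun x ↦ 1 / (2 * r) * F x + 1 / (2 * s) * G x :=
    (hFi.const_mul _).add (hGi.const_mul _)
  have hsq : Integrable fun x ↦ (F x - G x) ^ 2 :=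
    hdom.mono' ((hFc.sub hGc).pow 2).aestronglyMeasurable (.of_forall fun x ↦ by
      rw [Real.norm_of_nonneg (sq_nonneg _)]
      exact hle x)
  refine ⟨fun x ↦ ∫ t in a..x, (F t - G t), ?_, ?_, ?_, ?_, ?_, ?_⟩
  · refine contDiff_infty_iff_deriv.2 ⟨fun x ↦ (hderiv x).differentiableAt, ?_⟩
    rw [hderiv']
    exact f.contDiff_normed.sub g.contDiff_normed
  · intro x hx
    simp only [hsub, Fone x hx.1, Gzero x hx.2, sub_zero]
  · intro x hx
    simp only [hsub, Fzero x hx, Gzero x (by linarith), sub_zero]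
  · intro x hx
    simp only [hsub, Fone x (by linarith), Gone x hx, sub_self]
  · rwa [hderiv']
  · rw [hderiv']
    refine (integral_mono hsq hdom hle).trans_eq ?_
    rw [integral_add (hFi.const_mul _) (hGi.const_mul _), integral_const_mul, integral_const_mul,
      hFint, hGint, mul_one, mul_one]

/-- The square well of depth `d` on `[p, q]` binds a smooth plateau as soon as its mass exceeds the
Dirichlet energy of the plateau. -/
theorem exists_isWell_of_lt {p q r s d M σ : ℝ} (hpq : p ≤ q) (hr : 0 < r) (hs : 0 < s)
    (hd : 0 ≤ d) (hp : -M ≤ p) (hq : q ≤ M) (hσ : 0 < σ → σ ≤ p - 2 * (r + 1))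
    (hmass : 1 / (2 * r) + 1 / (2 * s) < d * (q - p)) :
    ∃ τ ψ w, IsWell (M * (d * (q - p))) σ τ w ψ := by
  obtain ⟨ψ, hψ, hψ1, hψl, hψr, hψi, hψE⟩ := exists_smooth_plateau hpq hr hs
  have hform : (fun x ↦ (Set.Icc p q).indicator (fun _ ↦ -d) x * ψ x ^ 2) =
      (Set.Icc p q).indicator fun _ ↦ -d := by
    funext x
    by_cases hx : x ∈ Set.Icc p q
    · simp [hx, hψ1 x hx]
    · simp [hx]
  have hwi : Integrable ((Set.Icc p q).indicator fun _ : ℝ ↦ -d) :=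
    (integrable_indicator_iff measurableSet_Icc).2 (integrableOn_const (by simp))
  have hwψ : Integrable fun x ↦ (Set.Icc p q).indicator (fun _ ↦ -d) x * ψ x ^ 2 := by
    rwa [hform]
  have hτ {x : ℝ} (hx : max |p - 2 * (r + 1)| |q + 2 * (s + 1)| < |x|) :
      x ≤ p - 2 * (r + 1) ∨ q + 2 * (s + 1) ≤ x := by
    have h1 := (le_max_left _ _).trans_lt hx
    have h2 := (le_max_right _ _).trans_lt hx
    rcases abs_cases x with ⟨h, -⟩ | ⟨h, -⟩
    · exact .inr (by linarith [le_abs_self (q + 2 * (s + 1))])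
    · exact .inl (by linarith [neg_abs_le (p - 2 * (r + 1))])
  have hlt {x : ℝ} (hx : |x| < σ) : x ≤ p - 2 * (r + 1) :=
    (le_abs_self x).trans (hx.le.trans (hσ ((abs_nonneg x).trans_lt hx)))
  have hout {x : ℝ} (hx : x ≤ p - 2 * (r + 1) ∨ q + 2 * (s + 1) ≤ x) : x ∉ Set.Icc p q := by
    rintro ⟨h1, h2⟩
    rcases hx with hx | hx <;> linarith
  refine ⟨max |p - 2 * (r + 1)| |q + 2 * (s + 1)|, ψ, (Set.Icc p q).indicator fun _ ↦ -d,
    measurable_const.indicator measurableSet_Icc,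
    Set.indicator_nonpos fun _ _ ↦ by simpa using hd, ?_,
    fun x hx ↦ Set.indicator_of_notMem (hout (.inl (hlt hx))) _,
    fun x hx ↦ Set.indicator_of_notMem (hout (hτ hx)) _, hψ,
    fun x hx ↦ hψl x (hlt hx), fun x hx ↦ (hτ hx).elim (hψl x) (hψr x), hψi.add hwψ, ?_⟩
  · calc ∫⁻ x : ℝ, ENNReal.ofReal (|x| * |(Set.Icc p q).indicator (fun _ ↦ -d) x|)
        ≤ ∫⁻ x : ℝ, (Set.Icc p q).indicator (fun _ ↦ ENNReal.ofReal (M * d)) x := by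
          refine lintegral_mono fun x ↦ ?_
          by_cases hx : x ∈ Set.Icc p q
          · simp only [hx, Set.indicator_of_mem, abs_neg, abs_of_nonneg hd]
            exact ENNReal.ofReal_le_ofReal (mul_le_mul_of_nonneg_right
              (abs_le.2 ⟨hp.trans hx.1, hx.2.trans hq⟩) hd)
          · simp [hx]
      _ = ENNReal.ofReal (M * (d * (q - p))) := by
          rw [lintegral_indicator_const measurableSet_Icc, Real.volume_Icc,
            ← ENNReal.ofReal_mul (mul_nonneg (by linarith) hd), mul_assoc]
  · rw [integral_add hψi hwψ, hform, integral_indicator_const _ measurableSet_Icc,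
      Real.volume_real_Icc_of_le hpq, smul_eq_mul]
    linarith

theorem exists_isWell_near_zero {δ : ℝ} (hδ : 0 < δ) : ∃ τ ψ w, IsWell δ 0 τ w ψ := by
  obtain ⟨τ, ψ, w, h⟩ := exists_isWell_of_lt (p := -(δ / 2)) (q := δ / 2) (r := 1) (s := 1)
    (d := 2 / δ) (M := δ / 2) (σ := 0) (by linarith) one_pos one_pos (by positivity) le_rfl le_rfl
    (fun h ↦ absurd h (lt_irrefl 0)) (by field_simp; norm_num)
  refine ⟨τ, ψ, w, ?_⟩
  convert h using 1
  field_simp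
  norm_num

open Filter Topology in
theorem exists_isWell_away_from_zero {δ : ℝ} (hδ : 0 < δ) (σ : ℝ) (hσ : 0 ≤ σ) :
    ∃ τ ψ w, IsWell (1 + δ) σ τ w ψ := by
  have hlim : Tendsto (fun t : ℝ ↦ 1 + (σ + 7) / 2 * t⁻¹ + (σ + 3) * (t⁻¹ * t⁻¹)) atTop
      (𝓝 (1 + (σ + 7) / 2 * 0 + (σ + 3) * (0 * 0))) :=
    (tendsto_const_nhds.add (tendsto_inv_atTop_zero.const_mul _)).add
      ((tendsto_inv_atTop_zero.mul tendsto_inv_atTop_zero).const_mul _)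
  obtain ⟨t, ht, ht0⟩ := ((hlim.eventually_le_const (u := 1 + δ) (by simpa using hδ)).and
    (eventually_gt_atTop 0)).exists
  obtain ⟨τ, ψ, w, h⟩ := exists_isWell_of_lt (p := σ + 2 * (t + 1)) (q := σ + 2 * (t + 1) + 1)
    (r := t) (s := t ^ 2) (d := 1 / (2 * t) + 1 / t ^ 2) (M := σ + 2 * (t + 1) + 1) (σ := σ)
    (by linarith) ht0 (by positivity) (by positivity) (by linarith) le_rfl (fun _ ↦ by linarith)
    (by
      have : 1 / (2 * t ^ 2) < 1 / t ^ 2 :=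
        one_div_lt_one_div_of_lt (by positivity) (by nlinarith [sq_pos_of_pos ht0])
      linarith)
  refine ⟨τ, ψ, w, { h with mass_le := h.mass_le.trans (ENNReal.ofReal_le_ofReal ?_) }⟩
  refine Eq.trans_le ?_ ht
  field_simp
  ring

theorem isTrialSpace_bot : IsTrialSpace 0 0 (-1) 0 ⊥ where
  measurable := measurable_const
  nonpos _ := le_rfl
  mass_le := by simp
  potential_eq_zero _ _ := rfl
  contDiff φ hφ := by
    rw [(Submodule.mem_bot ℝ).1 hφ]
    exact contDiff_const
  eq_zero φ hφ x _ := by simp [(Submodule.mem_bot ℝ).1 hφ]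
  integrable φ hφ := by simp [(Submodule.mem_bot ℝ).1 hφ]
  finiteDimensional := inferInstance
  finrank_eq := finrank_bot ℝ (ℝ → ℝ)
  form_neg φ hφ hφ0 := absurd ((Submodule.mem_bot ℝ).1 hφ) hφ0

theorem exists_isTrialSpace {δ : ℝ} (hδ : 0 < δ) (n : ℕ) :
    ∃ ρ u V, IsTrialSpace (n + 1) (n + (n + 1) * δ) ρ u V := by
  induction n with
  | zero =>
    obtain ⟨τ, ψ, w, h⟩ := exists_isWell_near_zero hδ
    have hV := isTrialSpace_bot.sup_span (h.mono (le_max_left τ 0)) le_rfl hδ.le (by norm_num)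
      ((by norm_num : (-1 : ℝ) ≤ 0).trans (le_max_right _ _))
    have hκ : 0 + δ = (0 : ℕ) + ((0 : ℕ) + 1) * δ := by simp
    exact ⟨_, _, _, hκ ▸ hV⟩
  | succ n ih =>
    obtain ⟨ρ, u, V, h⟩ := ih
    obtain ⟨τ, ψ, w, h'⟩ := exists_isWell_away_from_zero hδ (|ρ| + 1) (by positivity)
    have hV := h.sup_span (h'.mono (le_max_left τ ρ)) (by positivity) (by positivity)
      (by linarith [le_abs_self ρ]) (le_max_right _ _)
    have hκ : (n : ℝ) + (n + 1) * δ + (1 + δ) = (n + 1 : ℕ) + ((n + 1 : ℕ) + 1) * δ := by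
      push_cast
      ring
    exact ⟨_, _, _, hκ ▸ hV⟩

/-- For every `N ≥ 1` and `ε > 0` there is a nonpositive potential `u` with
`∫ |x||u| ≤ N - 1 + ε` whose Schrödinger operator has at least `N` negative
eigenvalues, in the variational sense. -/
theorem exists_potential_with_N_negative_eigenvalues
    (N : ℕ) (hN : 1 ≤ N) (ε : ℝ) (hε : 0 < ε) :
    ∃ u : ℝ → ℝ, Measurable u ∧ (∀ x, u x ≤ 0) ∧
      (∫⁻ x : ℝ, ENNReal.ofReal (|x| * |u x|)) ≤ ENNReal.ofReal ((N : ℝ) - 1 + ε) ∧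
      ∃ V : Submodule ℝ (ℝ → ℝ),
        (∀ φ ∈ V, ContDiff ℝ (⊤ : ℕ∞) φ ∧ HasCompactSupport φ) ∧
        Module.finrank ℝ V = N ∧
        ∀ φ ∈ V, φ ≠ 0 → ∫ x : ℝ, (deriv φ x ^ 2 + u x * φ x ^ 2) < 0 := by
  obtain ⟨n, rfl⟩ := Nat.exists_eq_add_of_le' hN
  obtain ⟨ρ, u, V, h⟩ := exists_isTrialSpace (δ := ε / (n + 1)) (by positivity) n
  refine ⟨u, h.measurable, h.nonpos, h.mass_le.trans_eq ?_, V, fun φ hφ ↦ ⟨h.contDiff φ hφ, ?_⟩,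
    h.finrank_eq, h.form_neg⟩
  · congr 1
    push_cast
    field_simp
    ring
  · refine HasCompactSupport.intro (isCompact_closedBall (0 : ℝ) ρ) fun x hx ↦ ?_
    exact h.eq_zero φ hφ x (by simpa using hx)
end
end
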